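/- The sets 𝓞_w for w ∈ 𝕀_∞^ε(ι) are exactly the K-orbits of X: each is a single K-orbit, they are pairwise disjoint, and their union is X. Likewise, the sets 𝕺_w for w ∈ 𝕀_∞^ε(ι) are exactly the G⁰-orbits of X. Moreover, for each w ∈ 𝕀_∞^ε(ι) the intersection 𝓞_w ∩ 𝕺_w is a single K ∩ G⁰-orbit. -/

import Mathlib

noncomputable section

/-- The standard basis vector `e_ℓ` of `V = ℕ →₀ ℂ`. -/
def eB (ℓ : ℕ) : ℕ →₀ ℂ := Finsupp.single ℓ 1

/-- The bilinear form `ω(x,y) = xᵀ Ω y` on `V = ℕ →₀ ℂ`, where `Ω` is the block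
diagonal matrix encoded by the involution `ι` pairing adjacent indices:
`Ω i j = 0` unless `j = ι i`, and `Ω i (ι i) = 1` if `i ≤ ι i`, `= ε` if `ι i < i`. -/
def omegaInf (ε : ℂ) (ι : ℕ → ℕ) (x y : ℕ →₀ ℂ) : ℂ :=
  x.sum fun i xi => xi * ((if i ≤ ι i then (1 : ℂ) else ε) * y (ι i))

/-- The antilinear map `γ(x) = Ω · x̄` on `V = ℕ →₀ ℂ`. -/
def gammaInf (ε : ℂ) (ι : ℕ → ℕ) (x : ℕ →₀ ℂ) : ℕ →₀ ℂ :=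
  x.sum fun i xi => Finsupp.single (ι i) ((if ι i ≤ i then (1 : ℂ) else ε) * star xi)

/-- An admissible basis of `V`: a basis `v` with `v ℓ = e_ℓ` for all but finitely
many `ℓ`. -/
def IsAdmBasis (v : ℕ → ℕ →₀ ℂ) : Prop :=
  LinearIndependent ℂ v ∧ Submodule.span ℂ (Set.range v) = ⊤ ∧
    {ℓ : ℕ | v ℓ ≠ eB ℓ}.Finite

/-- The maximal generalized flag `F_σ(v)`, viewed as the collection of its subspaces
`F'_a = span{v_ℓ : σ ℓ < a}` and `F''_a = span{v_ℓ : σ ℓ ≤ a}` for `a ∈ A`. -/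
def flagSet {A : Type*} [LinearOrder A] (σ : ℕ → A) (v : ℕ → ℕ →₀ ℂ) :
    Set (Submodule ℂ (ℕ →₀ ℂ)) :=
  {W | (∃ a : A, W = Submodule.span ℂ {x | ∃ ℓ, σ ℓ < a ∧ x = v ℓ}) ∨
       (∃ a : A, W = Submodule.span ℂ {x | ∃ ℓ, σ ℓ ≤ a ∧ x = v ℓ})}

/-- `v` is a `w`-dual admissible basis: `ω(v_ℓ, v_k) = 0` if `ℓ ≠ w k`, and
`ω(v_ℓ, v_k) = ±1` if `ℓ = w k`. -/
def IsWDualInf (ε : ℂ) (ι : ℕ → ℕ) (w : ℕ → ℕ) (v : ℕ → ℕ →₀ ℂ) : Prop :=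
  ∀ k l : ℕ, (l ≠ w k → omegaInf ε ι (v l) (v k) = 0) ∧
    (l = w k → omegaInf ε ι (v l) (v k) = 1 ∨ omegaInf ε ι (v l) (v k) = -1)

/-- `v` is a `w`-conjugate admissible basis: `γ(v_k) = ± v_{w k}` for all `k`. -/
def IsWConjInf (ε : ℂ) (ι : ℕ → ℕ) (w : ℕ → ℕ) (v : ℕ → ℕ →₀ ℂ) : Prop :=
  ∀ k : ℕ, gammaInf ε ι (v k) = v (w k) ∨ gammaInf ε ι (v k) = -(v (w k))

/-- `w ∈ 𝕀_∞^ε(ι)`: `w` is an involution of `ℕ` with `w ℓ = ι ℓ` for all but finitely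
many `ℓ`, and without fixed points in type A2 (`ε = -1`). -/
def InIinf (ε : ℂ) (ι : ℕ → ℕ) (w : ℕ → ℕ) : Prop :=
  (∀ k, w (w k) = k) ∧ {ℓ : ℕ | w ℓ ≠ ι ℓ}.Finite ∧ (ε = -1 → ∀ k, w k ≠ k)

/-- `𝓞_w`: the set of generalized flags arising from admissible `w`-dual bases. -/
def OsetInf {A : Type*} [LinearOrder A] (σ : ℕ → A) (ε : ℂ) (ι : ℕ → ℕ) (w : ℕ → ℕ) :
    Set (Set (Submodule ℂ (ℕ →₀ ℂ))) :=
  {S | ∃ v, IsAdmBasis v ∧ IsWDualInf ε ι w v ∧ S = flagSet σ v}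

/-- `𝕺_w`: the set of generalized flags arising from admissible `w`-conjugate bases. -/
def OOsetInf {A : Type*} [LinearOrder A] (σ : ℕ → A) (ε : ℂ) (ι : ℕ → ℕ) (w : ℕ → ℕ) :
    Set (Set (Submodule ℂ (ℕ →₀ ℂ))) :=
  {S | ∃ v, IsAdmBasis v ∧ IsWConjInf ε ι w v ∧ S = flagSet σ v}

/-- `G(E)`: bijective linear endomorphisms of `V` fixing all but finitely many of the
basis vectors `e_ℓ`. -/
def GEset : Set ((ℕ →₀ ℂ) →ₗ[ℂ] (ℕ →₀ ℂ)) :=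
  {g | Function.Bijective g ∧ {ℓ : ℕ | g (eB ℓ) ≠ eB ℓ}.Finite}

/-- `K = {g ∈ G(E) : ω(gx,gy) = ω(x,y)}`. -/
def KsetInf (ε : ℂ) (ι : ℕ → ℕ) : Set ((ℕ →₀ ℂ) →ₗ[ℂ] (ℕ →₀ ℂ)) :=
  {g | g ∈ GEset ∧ ∀ x y, omegaInf ε ι (g x) (g y) = omegaInf ε ι x y}

/-- `G⁰ = {g ∈ G(E) : γ(gx) = g(γx)}`. -/
def G0setInf (ε : ℂ) (ι : ℕ → ℕ) : Set ((ℕ →₀ ℂ) →ₗ[ℂ] (ℕ →₀ ℂ)) :=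
  {g | g ∈ GEset ∧ ∀ x, gammaInf ε ι (g x) = g (gammaInf ε ι x)}

/-- The action of a linear map on a generalized flag (as a collection of subspaces). -/
def mapFlagS (g : (ℕ →₀ ℂ) →ₗ[ℂ] (ℕ →₀ ℂ)) (S : Set (Submodule ℂ (ℕ →₀ ℂ))) :
    Set (Submodule ℂ (ℕ →₀ ℂ)) :=
  (fun W => Submodule.map g W) '' S

/-- The ind-variety `X`: the `G(E)`-orbit of the generalized flag `F_σ = F_σ(E)`. -/
def Xinf {A : Type*} [LinearOrder A] (σ : ℕ → A) : Set (Set (Submodule ℂ (ℕ →₀ ℂ))) :=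
  {S | ∃ g ∈ GEset, S = mapFlagS g (flagSet σ eB)}

/-- `O` is a single orbit of the group `G` on the set `X` of generalized flags. -/
def IsOrbitS (G : Set ((ℕ →₀ ℂ) →ₗ[ℂ] (ℕ →₀ ℂ)))
    (X O : Set (Set (Submodule ℂ (ℕ →₀ ℂ)))) : Prop :=
  ∃ S₀ ∈ X, O = {S | ∃ g ∈ G, S = mapFlagS g S₀}

theorem map_eq_of_map_le {T : (ℕ →₀ ℂ) →ₗ[ℂ] (ℕ →₀ ℂ)}
    (hT : Function.Injective T) [FiniteDimensional ℂ (LinearMap.range (T - 1))]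
    {W : Submodule ℂ (ℕ →₀ ℂ)} (h : W.map T ≤ W) : W.map T = W := by
  refine le_antisymm h fun x hx => ?_
  let U : Submodule ℂ (ℕ →₀ ℂ) := W ⊓ (Submodule.span ℂ {x} ⊔ LinearMap.range (T - 1))
  have hU : ∀ z ∈ U, T z ∈ U := by
    rintro z ⟨hz, hz'⟩
    refine ⟨h ⟨z, hz, rfl⟩, ?_⟩
    have : T z = z + (T - 1) z := by simp
    rw [this]
    exact add_mem hz' (Submodule.mem_sup_right ⟨z, rfl⟩)
  have : FiniteDimensional ℂ U := Submodule.finiteDimensional_of_le inf_le_right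
  have hinj : Function.Injective (T.restrict hU) := fun a b hab =>
    Subtype.ext (hT (congrArg Subtype.val hab))
  have hxU : x ∈ U := ⟨hx, Submodule.mem_sup_left (Submodule.mem_span_singleton_self x)⟩
  obtain ⟨z, hz⟩ := (LinearMap.injective_iff_surjective (K := ℂ) (V := U)).1 hinj ⟨x, hxU⟩
  exact ⟨z, z.2.1, congrArg Subtype.val hz⟩

theorem surjective_of_injective_of_finite_range {T : (ℕ →₀ ℂ) →ₗ[ℂ] (ℕ →₀ ℂ)}
    (hT : Function.Injective T) [FiniteDimensional ℂ (LinearMap.range (T - 1))] :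
    Function.Surjective T := by
  have := map_eq_of_map_le hT (W := ⊤) le_top
  rwa [Submodule.map_top, LinearMap.range_eq_top] at this

theorem injective_of_surjective_of_finite_range {T : (ℕ →₀ ℂ) →ₗ[ℂ] (ℕ →₀ ℂ)}
    (hT : Function.Surjective T) [FiniteDimensional ℂ (LinearMap.range (T - 1))] :
    Function.Injective T := by
  obtain ⟨S, hS⟩ := T.exists_rightInverse_of_surjective (LinearMap.range_eq_top.2 hT)
  have hS' : ∀ x, T (S x) = x := fun x => LinearMap.congr_fun hS x
  have hinj : Function.Injective S := Function.LeftInverse.injective hS'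
  have hle : LinearMap.range (S - 1) ≤ LinearMap.range (T - 1) := by
    rintro _ ⟨x, rfl⟩
    refine ⟨-S x, ?_⟩
    simp [hS', neg_add_eq_sub]
  have : FiniteDimensional ℂ (LinearMap.range (S - 1)) := Submodule.finiteDimensional_of_le hle
  intro a b hab
  obtain ⟨a, rfl⟩ := surjective_of_injective_of_finite_range hinj a
  obtain ⟨b, rfl⟩ := surjective_of_injective_of_finite_range hinj b
  rw [hS', hS'] at hab
  rw [hab]

theorem finiteDimensional_range_sub_one {T : (ℕ →₀ ℂ) →ₗ[ℂ] (ℕ →₀ ℂ)}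
    (hT : {l | T (eB l) ≠ eB l}.Finite) : FiniteDimensional ℂ (LinearMap.range (T - 1)) := by
  have hle : LinearMap.range (T - 1) ≤
      Submodule.span ℂ ((fun l => T (eB l) - eB l) '' {l | T (eB l) ≠ eB l}) := by
    rintro _ ⟨x, rfl⟩
    induction x using Finsupp.induction_linear with
    | zero => simp
    | add f g hf hg => rw [map_add]; exact add_mem hf hg
    | single l c =>
      have : Finsupp.single l c = c • eB l := by simp [eB]
      rw [this, map_smul]
      refine Submodule.smul_mem _ _ ?_
      by_cases h : T (eB l) = eB l
      · simp [h]
      · exact Submodule.subset_span ⟨l, h, rfl⟩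
  have := FiniteDimensional.span_of_finite ℂ (hT.image fun l => T (eB l) - eB l)
  exact Submodule.finiteDimensional_of_le hle

theorem linearCombination_eB (v : ℕ → ℕ →₀ ℂ) (l : ℕ) :
    Finsupp.linearCombination ℂ v (eB l) = v l := by
  simp [eB]

theorem finiteDimensional_range_linearCombination_sub_one {v : ℕ → ℕ →₀ ℂ}
    (hv : {l | v l ≠ eB l}.Finite) :
    FiniteDimensional ℂ (LinearMap.range (Finsupp.linearCombination ℂ v - 1)) :=
  finiteDimensional_range_sub_one (by simpa [linearCombination_eB] using hv)

theorem isAdmBasis_of_span {v : ℕ → ℕ →₀ ℂ} (hfin : {l | v l ≠ eB l}.Finite)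
    (hv : ∀ x, x ∈ Submodule.span ℂ (Set.range v)) : IsAdmBasis v := by
  have := finiteDimensional_range_linearCombination_sub_one hfin
  have hs : Function.Surjective (Finsupp.linearCombination ℂ v) := by
    rw [← LinearMap.range_eq_top, Finsupp.range_linearCombination]
    exact eq_top_iff.2 fun x _ => hv x
  exact ⟨injective_of_surjective_of_finite_range hs, eq_top_iff.2 fun x _ => hv x, hfin⟩

theorem isAdmBasis_of_linearIndependent {v : ℕ → ℕ →₀ ℂ} (hfin : {l | v l ≠ eB l}.Finite)
    (hv : LinearIndependent ℂ v) : IsAdmBasis v := by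
  have := finiteDimensional_range_linearCombination_sub_one hfin
  refine ⟨hv, ?_, hfin⟩
  rw [← Finsupp.range_linearCombination, LinearMap.range_eq_top]
  exact surjective_of_injective_of_finite_range hv

theorem isAdmBasis_eB : IsAdmBasis eB := by
  refine isAdmBasis_of_span (by simp) fun x => ?_
  rw [← Finsupp.range_linearCombination]
  refine ⟨x, ?_⟩
  induction x using Finsupp.induction_linear with
  | zero => simp
  | add f g hf hg => rw [map_add, hf, hg]
  | single l c => simp [eB]

/-- The basis of `V` given by an admissible family. -/
def IsAdmBasis.basis {v : ℕ → ℕ →₀ ℂ} (hv : IsAdmBasis v) : Module.Basis ℕ ℂ (ℕ →₀ ℂ) :=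
  Module.Basis.mk hv.1 hv.2.1.ge

@[simp] theorem IsAdmBasis.basis_apply {v : ℕ → ℕ →₀ ℂ} (hv : IsAdmBasis v) (l : ℕ) :
    hv.basis l = v l := by
  simp [IsAdmBasis.basis]

/-- The linear map sending one admissible basis to a given family. -/
def IsAdmBasis.mapTo {v : ℕ → ℕ →₀ ℂ} (hv : IsAdmBasis v) (u : ℕ → ℕ →₀ ℂ) :
    (ℕ →₀ ℂ) →ₗ[ℂ] (ℕ →₀ ℂ) :=
  hv.basis.constr ℂ u

@[simp] theorem IsAdmBasis.mapTo_apply {v : ℕ → ℕ →₀ ℂ} (hv : IsAdmBasis v)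
    (u : ℕ → ℕ →₀ ℂ) (l : ℕ) : hv.mapTo u (v l) = u l := by
  have := hv.basis.constr_basis ℂ u l
  rwa [hv.basis_apply] at this

theorem IsAdmBasis.mapTo_mem {v u : ℕ → ℕ →₀ ℂ} (hv : IsAdmBasis v) (hu : IsAdmBasis u) :
    hv.mapTo u ∈ GEset := by
  have hfin : {l | hv.mapTo u (eB l) ≠ eB l}.Finite := by
    refine (hv.2.2.union hu.2.2).subset fun l hl => ?_
    by_contra hcon
    simp only [Set.mem_union, Set.mem_ofPred_eq, not_or, not_not] at hcon
    apply hl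
    rw [← hcon.1, hv.mapTo_apply, hcon.1, hcon.2]
  have := finiteDimensional_range_sub_one hfin
  have hs : Function.Surjective (hv.mapTo u) := by
    rw [← LinearMap.range_eq_top, eq_top_iff, ← hu.2.1, Submodule.span_le]
    rintro _ ⟨l, rfl⟩
    exact ⟨v l, hv.mapTo_apply u l⟩
  exact ⟨⟨injective_of_surjective_of_finite_range hs, hs⟩, hfin⟩

theorem IsAdmBasis.comp {v : ℕ → ℕ →₀ ℂ} (hv : IsAdmBasis v)
    {g : (ℕ →₀ ℂ) →ₗ[ℂ] (ℕ →₀ ℂ)} (hg : g ∈ GEset) : IsAdmBasis fun l => g (v l) := by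
  refine isAdmBasis_of_linearIndependent ?_ (hv.1.map' g (LinearMap.ker_eq_bot.2 hg.1.1))
  refine (hv.2.2.union hg.2).subset fun l hl => ?_
  by_contra hcon
  simp only [Set.mem_union, Set.mem_ofPred_eq, not_or, not_not] at hcon
  exact hl (by simp only [hcon.1, hcon.2])

section Flags

variable {A : Type*} [LinearOrder A] (σ : ℕ → A)

/-- The subspace `F'_a` of the flag of `v`. -/
def flagLT (v : ℕ → ℕ →₀ ℂ) (a : A) : Submodule ℂ (ℕ →₀ ℂ) :=
  Submodule.span ℂ (v '' {l | σ l < a})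

/-- The subspace `F''_a` of the flag of `v`. -/
def flagLE (v : ℕ → ℕ →₀ ℂ) (a : A) : Submodule ℂ (ℕ →₀ ℂ) :=
  Submodule.span ℂ (v '' {l | σ l ≤ a})

/-- Two families span the same flag, index by index. -/
def SameFlag (v v' : ℕ → ℕ →₀ ℂ) : Prop :=
  ∀ a, flagLT σ v a = flagLT σ v' a ∧ flagLE σ v a = flagLE σ v' a

variable {σ}

theorem SameFlag.symm {v v' : ℕ → ℕ →₀ ℂ} (h : SameFlag σ v v') : SameFlag σ v' v :=
  fun a => ⟨(h a).1.symm, (h a).2.symm⟩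

theorem SameFlag.trans {v v' v'' : ℕ → ℕ →₀ ℂ} (h : SameFlag σ v v') (h' : SameFlag σ v' v'') :
    SameFlag σ v v'' :=
  fun a => ⟨(h a).1.trans (h' a).1, (h a).2.trans (h' a).2⟩

theorem mem_flagSet {v : ℕ → ℕ →₀ ℂ} {W : Submodule ℂ (ℕ →₀ ℂ)} :
    W ∈ flagSet σ v ↔ (∃ a, W = flagLT σ v a) ∨ ∃ a, W = flagLE σ v a := by
  simp only [flagSet, flagLT, flagLE, Set.image, Set.mem_ofPred_eq, eq_comm]

theorem SameFlag.flagSet_eq {v v' : ℕ → ℕ →₀ ℂ} (h : SameFlag σ v v') :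
    flagSet σ v = flagSet σ v' := by
  ext W
  simp only [mem_flagSet, (h _).1, (h _).2]

theorem mapFlagS_flagSet (g : (ℕ →₀ ℂ) →ₗ[ℂ] (ℕ →₀ ℂ)) (v : ℕ → ℕ →₀ ℂ) :
    mapFlagS g (flagSet σ v) = flagSet σ fun l => g (v l) := by
  have h1 : ∀ a, (flagLT σ v a).map g = flagLT σ (fun l => g (v l)) a := fun a => by
    rw [flagLT, flagLT, Submodule.map_span, ← Set.image_comp]; rfl
  have h2 : ∀ a, (flagLE σ v a).map g = flagLE σ (fun l => g (v l)) a := fun a => by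
    rw [flagLE, flagLE, Submodule.map_span, ← Set.image_comp]; rfl
  ext W
  simp only [mapFlagS, Set.mem_image, mem_flagSet]
  constructor
  · rintro ⟨U, ⟨a, rfl⟩ | ⟨a, rfl⟩, rfl⟩
    · exact Or.inl ⟨a, h1 a⟩
    · exact Or.inr ⟨a, h2 a⟩
  · rintro (⟨a, rfl⟩ | ⟨a, rfl⟩)
    · exact ⟨_, Or.inl ⟨a, rfl⟩, h1 a⟩
    · exact ⟨_, Or.inr ⟨a, rfl⟩, h2 a⟩

theorem mem_Xinf {S : Set (Submodule ℂ (ℕ →₀ ℂ))} :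
    S ∈ Xinf σ ↔ ∃ v, IsAdmBasis v ∧ S = flagSet σ v := by
  constructor
  · rintro ⟨g, hg, rfl⟩
    exact ⟨_, isAdmBasis_eB.comp hg, mapFlagS_flagSet g eB⟩
  · rintro ⟨v, hv, rfl⟩
    refine ⟨isAdmBasis_eB.mapTo v, isAdmBasis_eB.mapTo_mem hv, ?_⟩
    rw [mapFlagS_flagSet]
    simp

theorem span_image_eq_of_subset {v v' : ℕ → ℕ →₀ ℂ} (hv : IsAdmBasis v) (hv' : IsAdmBasis v')
    {I : Set ℕ} (h : Submodule.span ℂ (v' '' I) ≤ Submodule.span ℂ (v '' I)) :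
    Submodule.span ℂ (v' '' I) = Submodule.span ℂ (v '' I) := by
  have hg := hv.mapTo_mem hv'
  have := finiteDimensional_range_sub_one hg.2
  have hmap : (Submodule.span ℂ (v '' I)).map (hv.mapTo v') = Submodule.span ℂ (v' '' I) := by
    rw [Submodule.map_span, ← Set.image_comp]
    congr 1
    exact Set.image_congr fun l _ => hv.mapTo_apply v' l
  rw [← hmap] at h ⊢
  exact map_eq_of_map_le hg.1.1 h

theorem span_image_eq_of_eq {v v' : ℕ → ℕ →₀ ℂ} (hv : IsAdmBasis v) (hv' : IsAdmBasis v')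
    {I J : Set ℕ} (hIJ : I ⊆ J ∨ J ⊆ I)
    (h : Submodule.span ℂ (v '' I) = Submodule.span ℂ (v' '' J)) :
    Submodule.span ℂ (v '' I) = Submodule.span ℂ (v' '' I) := by
  rcases hIJ with hIJ | hIJ
  · exact (span_image_eq_of_subset hv hv'
      ((Submodule.span_mono (Set.image_mono hIJ)).trans h.ge)).symm
  · exact span_image_eq_of_subset hv' hv
      (h.le.trans (Submodule.span_mono (Set.image_mono hIJ)))

theorem sameFlag_of_flagSet_eq {v v' : ℕ → ℕ →₀ ℂ} (hv : IsAdmBasis v) (hv' : IsAdmBasis v')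
    (h : flagSet σ v = flagSet σ v') : SameFlag σ v v' := by
  have key : ∀ I : Set ℕ, ((∃ a, I = {l | σ l < a}) ∨ ∃ a, I = {l | σ l ≤ a}) →
      Submodule.span ℂ (v '' I) = Submodule.span ℂ (v' '' I) := by
    intro I hI
    have hlow : ∀ I : Set ℕ, ((∃ a, I = {l | σ l < a}) ∨ ∃ a, I = {l | σ l ≤ a}) →
        ∀ k l, σ k ≤ σ l → l ∈ I → k ∈ I := by
      rintro I (⟨a, rfl⟩ | ⟨a, rfl⟩) k l hkl hl
      · exact hkl.trans_lt hl
      · exact hkl.trans hl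
    have hmem : Submodule.span ℂ (v '' I) ∈ flagSet σ v := by
      rw [mem_flagSet]
      rcases hI with ⟨a, rfl⟩ | ⟨a, rfl⟩
      · exact Or.inl ⟨a, rfl⟩
      · exact Or.inr ⟨a, rfl⟩
    obtain ⟨J, hJ, hIJ⟩ : ∃ J : Set ℕ, ((∃ a, J = {l | σ l < a}) ∨ ∃ a, J = {l | σ l ≤ a}) ∧
        Submodule.span ℂ (v '' I) = Submodule.span ℂ (v' '' J) := by
      rw [h, mem_flagSet] at hmem
      rcases hmem with ⟨a, ha⟩ | ⟨a, ha⟩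
      · exact ⟨_, Or.inl ⟨a, rfl⟩, ha⟩
      · exact ⟨_, Or.inr ⟨a, rfl⟩, ha⟩
    refine span_image_eq_of_eq hv hv' ?_ hIJ
    by_contra! hcon
    obtain ⟨i, hi, hi'⟩ := Set.not_subset.1 hcon.1
    obtain ⟨j, hj, hj'⟩ := Set.not_subset.1 hcon.2
    rcases le_total (σ i) (σ j) with hij | hij
    · exact hi' (hlow J hJ i j hij hj)
    · exact hj' (hlow I hI j i hij hi)
  exact fun a => ⟨key _ (Or.inl ⟨a, rfl⟩), key _ (Or.inr ⟨a, rfl⟩)⟩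

theorem sameFlag_of_triangular {v v' : ℕ → ℕ →₀ ℂ}
    (h : ∀ k, ∃ c : ℂ, c ≠ 0 ∧ ∃ y ∈ flagLT σ v (σ k) ⊓ flagLT σ v' (σ k), v' k = c • v k + y) :
    SameFlag σ v v' := by
  have hlt : ∀ (u : ℕ → ℕ →₀ ℂ) (I : Set ℕ) (k : ℕ), (∀ i j, σ i ≤ σ j → j ∈ I → i ∈ I) →
      k ∈ I → flagLT σ u (σ k) ≤ Submodule.span ℂ (u '' I) := fun u I k hI hk =>
    Submodule.span_mono (Set.image_mono fun i hi => hI i k (le_of_lt hi) hk)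
  have key : ∀ I : Set ℕ, (∀ i j, σ i ≤ σ j → j ∈ I → i ∈ I) →
      Submodule.span ℂ (v '' I) = Submodule.span ℂ (v' '' I) := by
    intro I hI
    apply le_antisymm <;> rw [Submodule.span_le] <;> rintro _ ⟨k, hk, rfl⟩
    · obtain ⟨c, hc, y, hy, hk'⟩ := h k
      have : v k = c⁻¹ • (v' k - y) := by
        rw [hk', add_sub_cancel_right, smul_smul, inv_mul_cancel₀ hc, one_smul]
      rw [this]
      exact Submodule.smul_mem _ _ (sub_mem (Submodule.subset_span ⟨k, hk, rfl⟩)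
        (hlt v' I k hI hk hy.2))
    · obtain ⟨c, hc, y, hy, hk'⟩ := h k
      rw [hk']
      exact add_mem (Submodule.smul_mem _ _ (Submodule.subset_span ⟨k, hk, rfl⟩))
        (hlt v I k hI hk hy.1)
  exact fun a => ⟨key _ fun i j hij hj => hij.trans_lt hj, key _ fun i j hij hj => hij.trans hj⟩

theorem SameFlag.isAdmBasis {v v' : ℕ → ℕ →₀ ℂ} (h : SameFlag σ v v') (hv : IsAdmBasis v)
    (hfin : {l | v' l ≠ v l}.Finite) : IsAdmBasis v' := by
  refine isAdmBasis_of_span ?_ fun x => ?_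
  · refine (hv.2.2.union hfin).subset fun l hl => ?_
    by_contra hcon
    simp only [Set.mem_union, Set.mem_ofPred_eq, not_or, not_not] at hcon
    exact hl (by rw [hcon.2, hcon.1])
  · have hx : x ∈ Submodule.span ℂ (Set.range v) := hv.2.1 ▸ Submodule.mem_top
    refine Submodule.span_le.2 ?_ hx
    rintro _ ⟨k, rfl⟩
    have : v k ∈ flagLE σ v' (σ k) :=
      (h (σ k)).2 ▸ Submodule.subset_span ⟨k, le_refl (σ k), rfl⟩
    exact Submodule.span_mono (Set.image_subset_range _ _) this

theorem mem_flagLT {v : ℕ → ℕ →₀ ℂ} {k : ℕ} {a : A} (h : σ k < a) : v k ∈ flagLT σ v a :=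
  Submodule.subset_span ⟨k, h, rfl⟩

theorem mem_flagLE {v : ℕ → ℕ →₀ ℂ} {k : ℕ} {a : A} (h : σ k ≤ a) : v k ∈ flagLE σ v a :=
  Submodule.subset_span ⟨k, h, rfl⟩

theorem mem_flagLE_iff (hσ : Function.Injective σ) {v : ℕ → ℕ →₀ ℂ} {k : ℕ} {x : ℕ →₀ ℂ} :
    x ∈ flagLE σ v (σ k) ↔ ∃ c : ℂ, ∃ y ∈ flagLT σ v (σ k), x = c • v k + y := by
  have : {l | σ l ≤ σ k} = insert k {l | σ l < σ k} := by
    ext l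
    simp [le_iff_eq_or_lt, hσ.eq_iff]
  rw [flagLE, this, Set.image_insert_eq, Submodule.mem_span_insert]
  rfl

theorem IsAdmBasis.notMem_flagLT {v : ℕ → ℕ →₀ ℂ} (hv : IsAdmBasis v) (k : ℕ) :
    v k ∉ flagLT σ v (σ k) :=
  hv.1.notMem_span_image (s := {l | σ l < σ k}) (lt_irrefl (σ k))

theorem SameFlag.exists_eq (hσ : Function.Injective σ) {v v' : ℕ → ℕ →₀ ℂ}
    (h : SameFlag σ v v') (hv : IsAdmBasis v) (k : ℕ) :
    ∃ c : ℂ, c ≠ 0 ∧ ∃ y ∈ flagLT σ v' (σ k), v k = c • v' k + y := by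
  have hk : v k ∈ flagLE σ v' (σ k) := (h (σ k)).2 ▸ mem_flagLE le_rfl
  obtain ⟨c, y, hy, hk⟩ := (mem_flagLE_iff hσ).1 hk
  refine ⟨c, ?_, y, hy, hk⟩
  rintro rfl
  rw [zero_smul, zero_add] at hk
  exact hv.notMem_flagLT (σ := σ) k (by rw [(h (σ k)).1, hk]; exact hy)

end Flags

section Forms

/-- The coefficient `Ω i (ι i)`. -/
def omegaSign (ε : ℂ) (ι : ℕ → ℕ) (i : ℕ) : ℂ := if i ≤ ι i then 1 else ε

theorem omegaSign_mul {ε : ℂ} {ι : ℕ → ℕ} (hι : ∀ l, ι (ι l) = l)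
    (htype : ε = 1 ∨ (ε = -1 ∧ ∀ l, ι l ≠ l)) (i : ℕ) :
    omegaSign ε ι i * omegaSign ε ι (ι i) = ε := by
  rcases htype with rfl | ⟨-, h⟩
  · simp [omegaSign]
  · have := h i
    rcases lt_or_gt_of_ne this with h | h <;> simp [omegaSign, hι, h.le, h.not_ge]

theorem omegaSign_eq {ε : ℂ} {ι : ℕ → ℕ} (hε : ε = 1 ∨ ε = -1) (i : ℕ) :
    omegaSign ε ι i = 1 ∨ omegaSign ε ι i = -1 := by
  rcases hε with rfl | rfl <;> simp only [omegaSign] <;> split_ifs <;> simp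

variable (ε : ℂ) (ι : ℕ → ℕ)

/-- `ω` as a bilinear map. -/
def omegaBilin : (ℕ →₀ ℂ) →ₗ[ℂ] (ℕ →₀ ℂ) →ₗ[ℂ] ℂ :=
  LinearMap.mk₂ ℂ (omegaInf ε ι)
    (fun x x' y => by
      simp only [omegaInf]
      exact Finsupp.sum_add_index' (by simp) (by intros; ring))
    (fun c x y => by
      simp only [omegaInf]
      rw [Finsupp.sum_smul_index' (by simp), Finsupp.sum, Finsupp.sum, Finset.smul_sum]
      simp [mul_assoc])
    (fun x y y' => by
      simp only [omegaInf, Finsupp.sum, ← Finset.sum_add_distrib, Finsupp.add_apply]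
      exact Finset.sum_congr rfl fun _ _ => by ring)
    (fun c x y => by
      simp only [omegaInf, Finsupp.sum, Finsupp.smul_apply, smul_eq_mul, Finset.mul_sum]
      exact Finset.sum_congr rfl fun _ _ => by ring)

theorem omegaBilin_apply (x y : ℕ →₀ ℂ) : omegaBilin ε ι x y = omegaInf ε ι x y := rfl

/-- `γ` as an antilinear map. -/
def gammaMap : (ℕ →₀ ℂ) →ₛₗ[starRingEnd ℂ] (ℕ →₀ ℂ) where
  toFun := gammaInf ε ι
  map_add' x y := by
    simp only [gammaInf]
    exact Finsupp.sum_add_index' (by simp) (by intros; rw [← Finsupp.single_add, star_add, mul_add])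
  map_smul' c x := by
    simp only [gammaInf]
    rw [Finsupp.sum_smul_index' (by simp), Finsupp.sum, Finsupp.sum, Finset.smul_sum]
    refine Finset.sum_congr rfl fun i _ => ?_
    simp only [smul_eq_mul, star_mul', Finsupp.smul_single, starRingEnd_apply]
    congr 1
    ring

theorem gammaMap_apply (x : ℕ →₀ ℂ) : gammaMap ε ι x = gammaInf ε ι x := rfl

/-- The standard Hermitian form on `V`. -/
def hermForm : (ℕ →₀ ℂ) →ₗ[ℂ] (ℕ →₀ ℂ) →ₛₗ[starRingEnd ℂ] ℂ :=
  LinearMap.mk₂'ₛₗ (RingHom.id ℂ) (starRingEnd ℂ)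
    (fun x y => x.sum fun i xi => xi * starRingEnd ℂ (y i))
    (fun x x' y => Finsupp.sum_add_index' (by simp) (by intros; ring))
    (fun c x y => by
      rw [Finsupp.sum_smul_index' (by simp), Finsupp.sum, Finsupp.sum, Finset.smul_sum]
      simp [mul_assoc])
    (fun x y y' => by
      simp only [Finsupp.sum, ← Finset.sum_add_distrib, Finsupp.add_apply, map_add]
      exact Finset.sum_congr rfl fun _ _ => by ring)
    (fun c x y => by
      simp only [Finsupp.sum, Finsupp.smul_apply, smul_eq_mul, map_mul, Finset.mul_sum]
      exact Finset.sum_congr rfl fun _ _ => by ring)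

theorem hermForm_apply (x y : ℕ →₀ ℂ) :
    hermForm x y = x.sum fun i xi => xi * starRingEnd ℂ (y i) := rfl

theorem hermForm_symm (x y : ℕ →₀ ℂ) : hermForm x y = starRingEnd ℂ (hermForm y x) := by
  rw [hermForm_apply, hermForm_apply, Finsupp.sum_of_support_subset _
      (Finset.subset_union_left (s₂ := y.support)) _ (by simp),
    Finsupp.sum_of_support_subset y (Finset.subset_union_right (s₁ := x.support)) _ (by simp),
    map_sum]
  refine Finset.sum_congr rfl fun i _ => ?_
  simp [mul_comm]

theorem hermForm_self (x : ℕ →₀ ℂ) :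
    ∃ r : ℝ, 0 ≤ r ∧ hermForm x x = r ∧ (r = 0 → x = 0) := by
  refine ⟨x.sum fun i xi => Complex.normSq xi,
    Finset.sum_nonneg fun i _ => Complex.normSq_nonneg _, ?_, fun h => ?_⟩
  · rw [hermForm_apply, Finsupp.sum, Finsupp.sum, Complex.ofReal_sum]
    exact Finset.sum_congr rfl fun i _ => Complex.mul_conj _
  · rw [Finsupp.sum, Finset.sum_eq_zero_iff_of_nonneg fun i _ => Complex.normSq_nonneg _] at h
    ext i
    by_cases hi : i ∈ x.support
    · exact Complex.normSq_eq_zero.1 (h i hi)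
    · simpa using hi

theorem hermForm_eB (k l : ℕ) : hermForm (eB l) (eB k) = if l = k then 1 else 0 := by
  rw [hermForm_apply, eB, Finsupp.sum_single_index (by simp), eB, Finsupp.single_apply]
  by_cases h : k = l <;> simp [h, eq_comm]

theorem omegaInf_eB (k l : ℕ) :
    omegaInf ε ι (eB l) (eB k) = if ι l = k then omegaSign ε ι l else 0 := by
  rw [omegaInf, eB, Finsupp.sum_single_index (by simp), eB, Finsupp.single_apply]
  by_cases h : k = ι l <;> simp [h, omegaSign, eq_comm]

variable {ε ι}

theorem gammaInf_eB (hι : ∀ l, ι (ι l) = l) (l : ℕ) :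
    gammaInf ε ι (eB l) = omegaSign ε ι (ι l) • eB (ι l) := by
  rw [gammaInf, eB, Finsupp.sum_single_index (by simp), eB, Finsupp.smul_single]
  simp [omegaSign, hι]

theorem gammaInf_single (hι : ∀ l, ι (ι l) = l) (i : ℕ) (c : ℂ) :
    gammaInf ε ι (Finsupp.single i c) =
      Finsupp.single (ι i) (omegaSign ε ι (ι i) * starRingEnd ℂ c) := by
  rw [gammaInf, Finsupp.sum_single_index (by simp)]
  simp [omegaSign, hι]

theorem gammaInf_apply (hι : ∀ l, ι (ι l) = l) (x : ℕ →₀ ℂ) (j : ℕ) :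
    gammaInf ε ι x j = omegaSign ε ι j * starRingEnd ℂ (x (ι j)) := by
  simp only [← gammaMap_apply]
  induction x using Finsupp.induction_linear with
  | zero => simp
  | add f g hf hg => rw [map_add, Finsupp.add_apply, hf, hg, Finsupp.add_apply, map_add, mul_add]
  | single i c =>
    rw [gammaMap_apply, gammaInf_single hι, Finsupp.single_apply, Finsupp.single_apply]
    by_cases h : ι i = j
    · have : i = ι j := by rw [← h, hι]
      simp [this, hι]
    · have : ¬ i = ι j := fun h' => h (by rw [h', hι])
      simp [h, this]

theorem eps_eq (htype : ε = 1 ∨ (ε = -1 ∧ ∀ l, ι l ≠ l)) : ε = 1 ∨ ε = -1 :=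
  htype.imp_right And.left

theorem eps_mul_eps (hε : ε = 1 ∨ ε = -1) : ε * ε = 1 := by
  rcases hε with rfl | rfl <;> simp

theorem star_omegaSign (hε : ε = 1 ∨ ε = -1) (i : ℕ) :
    starRingEnd ℂ (omegaSign ε ι i) = omegaSign ε ι i := by
  rcases omegaSign_eq (ι := ι) hε i with h | h <;> simp [h]

theorem gammaInf_gammaInf (hι : ∀ l, ι (ι l) = l)
    (htype : ε = 1 ∨ (ε = -1 ∧ ∀ l, ι l ≠ l)) (x : ℕ →₀ ℂ) : gammaInf ε ι (gammaInf ε ι x) = ε • x := by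
  ext j
  rw [gammaInf_apply hι, gammaInf_apply hι, hι, map_mul, Complex.conj_conj,
    star_omegaSign (eps_eq htype), ← mul_assoc, omegaSign_mul hι htype]
  rfl

theorem omegaInf_gammaInf (hι : ∀ l, ι (ι l) = l)
    (htype : ε = 1 ∨ (ε = -1 ∧ ∀ l, ι l ≠ l)) (x y : ℕ →₀ ℂ) : omegaInf ε ι x (gammaInf ε ι y) = ε * hermForm x y := by
  rw [omegaInf, hermForm_apply, Finsupp.sum, Finsupp.sum, Finset.mul_sum]
  refine Finset.sum_congr rfl fun i _ => ?_
  rw [gammaInf_apply hι, hι]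
  change _ * (omegaSign ε ι i * _) = _
  linear_combination (x i * starRingEnd ℂ (y i)) * omegaSign_mul hι htype i

theorem omegaInf_symm (hι : ∀ l, ι (ι l) = l)
    (htype : ε = 1 ∨ (ε = -1 ∧ ∀ l, ι l ≠ l)) (x y : ℕ →₀ ℂ) : omegaInf ε ι x y = ε * omegaInf ε ι y x := by
  simp only [← omegaBilin_apply]
  induction x using Finsupp.induction_linear with
  | zero => simp
  | add f g hf hg => rw [map_add, map_add, LinearMap.add_apply, hf, hg, mul_add]
  | single i a =>
    induction y using Finsupp.induction_linear with
    | zero => simp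
    | add f g hf hg => rw [map_add, map_add, LinearMap.add_apply, hf, hg, mul_add]
    | single j b =>
      have h1 : Finsupp.single i a = a • eB i := by simp [eB]
      have h2 : Finsupp.single j b = b • eB j := by simp [eB]
      rw [h1, h2]
      simp only [map_smul, LinearMap.smul_apply, omegaBilin_apply, omegaInf_eB, smul_eq_mul]
      by_cases h : ι i = j
      · subst h
        simp only [hι, if_true]
        have h3 := omegaSign_mul hι htype i
        have h4 : omegaSign ε ι (ι i) * omegaSign ε ι (ι i) = 1 := by
          rcases omegaSign_eq (ι := ι) (eps_eq htype) (ι i) with h | h <;> simp [h]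
        linear_combination (-(a * b * omegaSign ε ι i)) * h4 + (a * b * omegaSign ε ι (ι i)) * h3
      · have : ¬ ι j = i := fun h' => h (by rw [← h', hι])
        simp [h, this]

theorem hermForm_gammaInf_left (hι : ∀ l, ι (ι l) = l)
    (htype : ε = 1 ∨ (ε = -1 ∧ ∀ l, ι l ≠ l)) (x z : ℕ →₀ ℂ) :
    hermForm (gammaInf ε ι x) z = starRingEnd ℂ (omegaInf ε ι z x) := by
  have h : omegaInf ε ι z (gammaInf ε ι (gammaInf ε ι x)) = ε * hermForm z (gammaInf ε ι x) :=
    omegaInf_gammaInf hι htype z _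
  rw [gammaInf_gammaInf hι htype, ← omegaBilin_apply, map_smul, omegaBilin_apply, smul_eq_mul] at h
  have hε : ε ≠ 0 := by rcases htype with rfl | ⟨rfl, -⟩ <;> simp
  rw [hermForm_symm, ← mul_left_cancel₀ hε h]

theorem hermForm_gammaInf_gammaInf (hι : ∀ l, ι (ι l) = l)
    (htype : ε = 1 ∨ (ε = -1 ∧ ∀ l, ι l ≠ l)) (x y : ℕ →₀ ℂ) :
    hermForm (gammaInf ε ι x) (gammaInf ε ι y) = starRingEnd ℂ (hermForm x y) := by
  rw [hermForm_gammaInf_left hι htype, omegaInf_symm hι htype, omegaInf_gammaInf hι htype,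
    ← mul_assoc, eps_mul_eps (eps_eq htype), one_mul]

theorem eq_zero_of_omegaInf (hι : ∀ l, ι (ι l) = l)
    (htype : ε = 1 ∨ (ε = -1 ∧ ∀ l, ι l ≠ l)) {x : ℕ →₀ ℂ} (h : ∀ y, omegaInf ε ι y x = 0) : x = 0 := by
  obtain ⟨r, -, hr, hr'⟩ := hermForm_self x
  refine hr' ?_
  have h1 := hermForm_gammaInf_left hι htype x (gammaInf ε ι x)
  rw [h, map_zero, hermForm_gammaInf_gammaInf hι htype, hr] at h1
  simpa using h1

end Forms

section FormElimination

variable {A : Type*} [LinearOrder A] {σ : ℕ → A} {ρ : ℂ →+* ℂ}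

/-- `v` spans the same flag as `v₀`, and its Gram matrix with respect to `B` is, away from the
indices in `T`, a signed permutation matrix for the involution `w`. -/
structure FormReduced (σ : ℕ → A) (B : (ℕ →₀ ℂ) →ₗ[ℂ] (ℕ →₀ ℂ) →ₛₗ[ρ] ℂ) (ι₀ : ℕ → ℕ)
    (v₀ : ℕ → ℕ →₀ ℂ) (T : Finset ℕ) (w : ℕ → ℕ) (v : ℕ → ℕ →₀ ℂ) : Prop where
  adm : IsAdmBasis v
  flag : SameFlag σ v₀ v
  invol : ∀ k, w (w k) = k
  fin : {k | w k ≠ ι₀ k}.Finite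
  fix : ∀ k ∈ T, w k = k
  zero : ∀ k ∉ T, ∀ l, l ≠ w k → B (v l) (v k) = 0
  pm : ∀ k ∉ T, B (v (w k)) (v k) = 1 ∨ B (v (w k)) (v k) = -1

namespace FormReduced

variable {B : (ℕ →₀ ℂ) →ₗ[ℂ] (ℕ →₀ ℂ) →ₛₗ[ρ] ℂ} {ι₀ : ℕ → ℕ} {v₀ : ℕ → ℕ →₀ ℂ}
  {T : Finset ℕ} {w : ℕ → ℕ} {v : ℕ → ℕ →₀ ℂ} {η : ℂ}

theorem apply_notMem (h : FormReduced σ B ι₀ v₀ T w v) {k : ℕ} (hk : k ∉ T) : w k ∉ T :=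
  fun hw => hk (by have := h.fix _ hw; rw [h.invol] at this; rwa [this])

theorem zero_of_mem (h : FormReduced σ B ι₀ v₀ T w v) {k l : ℕ} (hk : k ∉ T) (hl : l ∈ T) :
    B (v l) (v k) = 0 :=
  h.zero k hk l fun h' => h.apply_notMem hk (h' ▸ hl)

theorem zero_of_mem' (h : FormReduced σ B ι₀ v₀ T w v)
    (hB : ∀ x y, B x y = η * ρ (B y x)) {k l : ℕ} (hk : k ∉ T) (hl : l ∈ T) :
    B (v k) (v l) = 0 := by
  rw [hB, h.zero_of_mem hk hl, map_zero, mul_zero]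

theorem exists_step_fixed (hσ : Function.Injective σ) (h : FormReduced σ B ι₀ v₀ T w v)
    (hB : ∀ x y, B x y = η * ρ (B y x)) (hsc : ∀ x, B x x ≠ 0 → ∃ d, d * ρ d * B x x = 1)
    {l : ℕ} (hl : l ∈ T) (hmin : ∀ k ∈ T, σ l ≤ σ k) (hne : B (v l) (v l) ≠ 0) :
    ∃ v', FormReduced σ B ι₀ v₀ (T.erase l) w v' := by
  obtain ⟨d, hd⟩ := hsc _ hne
  have hd0 : d ≠ 0 := by rintro rfl; simp at hd
  have hlt : ∀ k ∈ T, k ≠ l → σ l < σ k := fun k hk hkl =>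
    lt_of_le_of_ne (hmin k hk) fun h' => hkl (hσ h').symm
  obtain ⟨v', hv'⟩ : ∃ v' : ℕ → ℕ →₀ ℂ, v' = fun k => if k = l then d • v l else
      if k ∈ T then v k - (B (v k) (v l) / B (v l) (v l)) • v l else v k := ⟨_, rfl⟩
  have hv'l : v' l = d • v l := by simp [hv']
  have hv'T : ∀ k ∈ T, k ≠ l → v' k = v k - (B (v k) (v l) / B (v l) (v l)) • v l := by
    intro k hk hkl; simp [hv', hk, hkl]
  have hv'n : ∀ k ∉ T, v' k = v k := by
    intro k hk
    have : k ≠ l := by rintro rfl; exact hk hl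
    simp [hv', hk, this]
  have htri : SameFlag σ v v' := by
    refine sameFlag_of_triangular fun k => ?_
    by_cases hkl : k = l
    · subst hkl
      exact ⟨d, hd0, 0, zero_mem _, by rw [hv'l, add_zero]⟩
    by_cases hk : k ∈ T
    · refine ⟨1, one_ne_zero, -((B (v k) (v l) / B (v l) (v l)) • v l), ⟨?_, ?_⟩, ?_⟩
      · exact neg_mem (Submodule.smul_mem _ _ (mem_flagLT (hlt k hk hkl)))
      · have h1 : v l = d⁻¹ • v' l := by rw [hv'l, smul_smul, inv_mul_cancel₀ hd0, one_smul]
        rw [h1]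
        exact neg_mem (Submodule.smul_mem _ _ (Submodule.smul_mem _ _ (mem_flagLT (hlt k hk hkl))))
      · rw [hv'T k hk hkl, one_smul, sub_eq_add_neg]
    · exact ⟨1, one_ne_zero, 0, zero_mem _, by rw [hv'n k hk, one_smul, add_zero]⟩
  refine ⟨v', htri.isAdmBasis h.adm ?_, h.flag.trans htri, h.invol, h.fin,
    fun k hk => h.fix k (Finset.mem_of_mem_erase hk), ?_, ?_⟩
  · refine T.finite_toSet.subset fun k hk => ?_
    by_contra hkT
    exact hk (hv'n k hkT)
  · intro k hk j hj
    by_cases hkl : k = l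
    · subst hkl
      rw [h.fix _ hl] at hj
      rw [hv'l, map_smulₛₗ]
      by_cases hjT : j ∈ T
      · rw [hv'T j hjT hj, map_sub, map_smul, LinearMap.sub_apply, LinearMap.smul_apply,
          smul_eq_mul (B _ _ / _), div_mul_cancel₀ _ hne, sub_self, smul_zero]
      · rw [hv'n j hjT, h.zero_of_mem' hB hjT hl, smul_zero]
    · have hkT : k ∉ T := fun h' => hk (Finset.mem_erase.2 ⟨hkl, h'⟩)
      rw [hv'n k hkT]
      by_cases hjT : j ∈ T
      · by_cases hjl : j = l
        · subst hjl
          rw [hv'l, map_smul, LinearMap.smul_apply, h.zero_of_mem hkT hl, smul_zero]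
        · rw [hv'T j hjT hjl, map_sub, map_smul, LinearMap.sub_apply, LinearMap.smul_apply,
            h.zero_of_mem hkT hl, h.zero_of_mem hkT hjT, smul_zero, sub_zero]
      · rw [hv'n j hjT, h.zero k hkT j hj]
  · intro k hk
    by_cases hkl : k = l
    · subst hkl
      left
      rw [h.fix _ hl, hv'l, map_smulₛₗ, map_smul, LinearMap.smul_apply, smul_eq_mul, smul_eq_mul,
        ← hd]
      ring
    · have hkT : k ∉ T := fun h' => hk (Finset.mem_erase.2 ⟨hkl, h'⟩)
      rw [hv'n k hkT, hv'n _ (h.apply_notMem hkT)]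
      exact h.pm k hkT

theorem exists_step_swap (hσ : Function.Injective σ) (h : FormReduced σ B ι₀ v₀ T w v)
    (hη : η = 1 ∨ η = -1) (hB : ∀ x y, B x y = η * ρ (B y x))
    {l m : ℕ} (hl : l ∈ T) (hmin : ∀ k ∈ T, σ l ≤ σ k) (hll : B (v l) (v l) = 0)
    (hm : m ∈ T) (hml : B (v m) (v l) ≠ 0)
    (hmmin : ∀ k ∈ T, B (v k) (v l) ≠ 0 → σ m ≤ σ k) :
    ∃ w' v', FormReduced σ B ι₀ v₀ ((T.erase l).erase m) w' v' := by
  have hlm : l ≠ m := by rintro rfl; exact hml hll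
  have hηη : η * η = 1 := by rcases hη with rfl | rfl <;> simp
  have hρη : ρ η = η := by rcases hη with rfl | rfl <;> simp
  have hlt : ∀ k ∈ T, k ≠ l → σ l < σ k := fun k hk hkl =>
    lt_of_le_of_ne (hmin k hk) fun h' => hkl (hσ h').symm
  obtain ⟨c, hc⟩ : ∃ c, c = (B (v m) (v l))⁻¹ := ⟨_, rfl⟩
  have hc0 : c ≠ 0 := hc ▸ inv_ne_zero hml
  obtain ⟨x, hx⟩ : ∃ x, x = c • v m := ⟨_, rfl⟩
  have hxl : B x (v l) = 1 := by
    rw [hx, map_smul, LinearMap.smul_apply, smul_eq_mul, hc, inv_mul_cancel₀ hml]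
  have hlx : B (v l) x = η := by rw [hB, hxl, map_one, mul_one]
  obtain ⟨a, ha⟩ : ∃ a, a = η * B x x / 2 := ⟨_, rfl⟩
  have hρa : ρ a = B x x / 2 := by
    rw [ha, map_div₀, map_mul, hρη, map_ofNat, ← hB]
  obtain ⟨u, hu⟩ : ∃ u, u = x - a • v l := ⟨_, rfl⟩
  have hul : B u (v l) = 1 := by
    rw [hu, map_sub, map_smul, LinearMap.sub_apply, LinearMap.smul_apply, hxl, hll, smul_zero,
      sub_zero]
  have hlu : B (v l) u = η := by rw [hB, hul, map_one, mul_one]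
  have huu : B u u = 0 := by
    nth_rewrite 2 [hu]
    rw [map_sub, map_smulₛₗ, hul, hu, map_sub, map_smul, LinearMap.sub_apply,
      LinearMap.smul_apply, hlx, hρa, ha, smul_eq_mul, smul_eq_mul]
    linear_combination (-(B x x) / 2) * hηη
  have huk : ∀ k ∉ T, B u (v k) = 0 := fun k hk => by
    rw [hu, hx, map_sub, map_smul, map_smul, LinearMap.sub_apply, LinearMap.smul_apply,
      LinearMap.smul_apply, h.zero_of_mem hk hl, h.zero_of_mem hk hm, smul_zero, smul_zero,
      sub_zero]
  have hku : ∀ k ∉ T, B (v k) u = 0 := fun k hk => by rw [hB, huk k hk, map_zero, mul_zero]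
  obtain ⟨v', hv'⟩ : ∃ v' : ℕ → ℕ →₀ ℂ, v' = fun k => if k = m then u else
      if k ∈ T.erase l then v k - (B (v k) (v l)) • u - (η * B (v k) u) • v l else v k :=
    ⟨_, rfl⟩
  have hv'm : v' m = u := by simp [hv']
  have hv'l : v' l = v l := by simp [hv', hlm]
  have hv'T : ∀ k ∈ T, k ≠ l → k ≠ m →
      v' k = v k - (B (v k) (v l)) • u - (η * B (v k) u) • v l := by
    intro k hk hkl hkm; simp [hv', hk, hkl, hkm]
  have hv'n : ∀ k ∉ T, v' k = v k := by
    intro k hk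
    have : k ≠ m := by rintro rfl; exact hk hm
    simp [hv', hk, this]
  have hT : ∀ k, k = l ∨ k = m ∨ (k ∈ T ∧ k ≠ l ∧ k ≠ m) ∨ k ∉ T := by
    intro k; tauto
  have hT' : ∀ k ∉ (T.erase l).erase m, k = l ∨ k = m ∨ k ∉ T := by
    intro k hk
    simp only [Finset.mem_erase] at hk
    tauto
  have htri : SameFlag σ v v' := by
    refine sameFlag_of_triangular fun k => ?_
    rcases hT k with rfl | rfl | ⟨hk, hkl, hkm⟩ | hk
    · exact ⟨1, one_ne_zero, 0, zero_mem _, by rw [hv'l, one_smul, add_zero]⟩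
    · refine ⟨c, hc0, -(a • v l), ⟨?_, ?_⟩, ?_⟩
      · exact neg_mem (Submodule.smul_mem _ _ (mem_flagLT (hlt _ hm hlm.symm)))
      · rw [← hv'l]
        exact neg_mem (Submodule.smul_mem _ _ (mem_flagLT (hlt _ hm hlm.symm)))
      · rw [hv'm, hu, hx, sub_eq_add_neg]
    · refine ⟨1, one_ne_zero, -(B (v k) (v l)) • u + -(η * B (v k) u) • v l, ⟨?_, ?_⟩, ?_⟩
      · refine add_mem ?_ (Submodule.smul_mem _ _ (mem_flagLT (hlt k hk hkl)))
        by_cases h0 : B (v k) (v l) = 0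
        · rw [h0, neg_zero, zero_smul]; exact zero_mem _
        · have hmk : σ m < σ k := lt_of_le_of_ne (hmmin k hk h0) fun h' => hkm (hσ h').symm
          rw [hu, hx]
          exact Submodule.smul_mem _ _ (sub_mem (Submodule.smul_mem _ _ (mem_flagLT hmk))
            (Submodule.smul_mem _ _ (mem_flagLT (hlt k hk hkl))))
      · rw [← hv'l, ← hv'm]
        refine add_mem ?_ (Submodule.smul_mem _ _ (mem_flagLT (hlt k hk hkl)))
        rw [hv'l]
        by_cases h0 : B (v k) (v l) = 0
        · rw [h0, neg_zero, zero_smul]; exact zero_mem _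
        · have hmk : σ m < σ k := lt_of_le_of_ne (hmmin k hk h0) fun h' => hkm (hσ h').symm
          exact Submodule.smul_mem _ _ (mem_flagLT hmk)
      · rw [hv'T k hk hkl hkm, one_smul]
        module
    · exact ⟨1, one_ne_zero, 0, zero_mem _, by rw [hv'n k hk, one_smul, add_zero]⟩
  obtain ⟨w', hw'⟩ : ∃ w' : ℕ → ℕ, w' = fun k => if k = l then m else if k = m then l else w k :=
    ⟨_, rfl⟩
  have hw'l : w' l = m := by simp [hw']
  have hw'm : w' m = l := by simp [hw', hlm.symm]
  have hw'n : ∀ k, k ≠ l → k ≠ m → w' k = w k := fun k h1 h2 => by simp [hw', h1, h2]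
  have hw'T : ∀ k ∉ T, w' k = w k := fun k hk =>
    hw'n k (by rintro rfl; exact hk hl) (by rintro rfl; exact hk hm)
  refine ⟨w', v', htri.isAdmBasis h.adm ?_, h.flag.trans htri, ?_, ?_, ?_, ?_, ?_⟩
  · refine T.finite_toSet.subset fun k hk => ?_
    by_contra hkT
    exact hk (hv'n k hkT)
  · intro k
    rcases hT k with rfl | rfl | ⟨hk, hkl, hkm⟩ | hk
    · rw [hw'l, hw'm]
    · rw [hw'm, hw'l]
    · rw [hw'n k hkl hkm, h.fix k hk, hw'n k hkl hkm, h.fix k hk]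
    · rw [hw'T k hk, hw'T _ (h.apply_notMem hk), h.invol]
  · refine (h.fin.union (Set.toFinite {l, m})).subset fun k hk => ?_
    by_contra hcon
    simp only [Set.mem_union, Set.mem_ofPred_eq, not_or, not_not, Set.mem_insert_iff,
      Set.mem_singleton_iff] at hcon
    exact hk (by rw [hw'n k hcon.2.1 hcon.2.2, hcon.1])
  · intro k hk
    simp only [Finset.mem_erase] at hk
    rw [hw'n k hk.2.1 hk.1, h.fix k hk.2.2]
  · intro k hk j hj
    rcases hT' k hk with rfl | rfl | hkT
    · rw [hw'l] at hj
      rw [hv'l]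
      rcases hT j with rfl | rfl | ⟨hjT, hjl, hjm⟩ | hjT
      · rw [hv'l, hll]
      · exact absurd rfl hj
      · rw [hv'T j hjT hjl hjm]
        simp only [map_sub, map_smul, LinearMap.sub_apply, LinearMap.smul_apply, hul, hll,
          smul_eq_mul]
        ring
      · rw [hv'n j hjT, h.zero_of_mem' hB hjT hl]
    · rw [hw'm] at hj
      rw [hv'm]
      rcases hT j with rfl | rfl | ⟨hjT, hjl, hjm⟩ | hjT
      · exact absurd rfl hj
      · rw [hv'm, huu]
      · rw [hv'T j hjT hjl hjm]
        simp only [map_sub, map_smul, LinearMap.sub_apply, LinearMap.smul_apply, hlu, huu,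
          smul_eq_mul]
        linear_combination (-(B (v j) u)) * hηη
      · rw [hv'n j hjT, hku j hjT]
    · rw [hw'T k hkT] at hj
      rw [hv'n k hkT]
      rcases hT j with rfl | rfl | ⟨hjT, hjl, hjm⟩ | hjT
      · rw [hv'l, h.zero_of_mem hkT hl]
      · rw [hv'm, huk k hkT]
      · rw [hv'T j hjT hjl hjm]
        simp only [map_sub, map_smul, LinearMap.sub_apply, LinearMap.smul_apply, huk k hkT,
          h.zero_of_mem hkT hl, h.zero_of_mem hkT hjT, smul_eq_mul]
        ring
      · rw [hv'n j hjT, h.zero k hkT j hj]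
  · intro k hk
    rcases hT' k hk with rfl | rfl | hkT
    · rw [hw'l, hv'm, hv'l]; exact Or.inl hul
    · rw [hw'm, hv'm, hv'l, hlu]; exact hη
    · rw [hw'T k hkT, hv'n k hkT, hv'n _ (h.apply_notMem hkT)]
      exact h.pm k hkT

theorem exists_empty (hσ : Function.Injective σ) (hη : η = 1 ∨ η = -1)
    (hB : ∀ x y, B x y = η * ρ (B y x)) (hsc : ∀ x, B x x ≠ 0 → ∃ d, d * ρ d * B x x = 1)
    (hnd : ∀ x, (∀ y, B y x = 0) → x = 0) (h : FormReduced σ B ι₀ v₀ T w v) :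
    ∃ w' v', FormReduced σ B ι₀ v₀ ∅ w' v' := by
  induction hn : T.card using Nat.strong_induction_on generalizing T w v with
  | _ n ih =>
    subst hn
    rcases T.eq_empty_or_nonempty with rfl | hT
    · exact ⟨w, v, h⟩
    obtain ⟨l, hl, hmin⟩ := T.exists_min_image σ hT
    by_cases hll : B (v l) (v l) = 0
    · have hne : (T.filter fun k => B (v k) (v l) ≠ 0).Nonempty := by
        by_contra hcon
        rw [Finset.not_nonempty_iff_eq_empty, Finset.filter_eq_empty_iff] at hcon
        have hz : ∀ k, B (v k) (v l) = 0 := fun k => by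
          by_cases hk : k ∈ T
          · simpa using hcon hk
          · exact h.zero_of_mem' hB hk hl
        refine h.adm.1.ne_zero l (hnd _ fun y => ?_)
        have hy : y ∈ Submodule.span ℂ (Set.range v) := h.adm.2.1 ▸ Submodule.mem_top
        induction hy using Submodule.span_induction with
        | mem x hx => obtain ⟨k, rfl⟩ := hx; exact hz k
        | zero => simp
        | add x y _ _ hx hy => rw [map_add, LinearMap.add_apply, hx, hy, add_zero]
        | smul c x _ hx => rw [map_smul, LinearMap.smul_apply, hx, smul_zero]
      obtain ⟨m, hm, hmmin⟩ := Finset.exists_min_image _ σ hne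
      rw [Finset.mem_filter] at hm
      obtain ⟨w', v', h'⟩ := h.exists_step_swap hσ hη hB hl hmin hll hm.1 hm.2
        fun k hk hk' => hmmin k (Finset.mem_filter.2 ⟨hk, hk'⟩)
      exact ih _ ((Finset.card_le_card (Finset.erase_subset _ _)).trans_lt
        (Finset.card_erase_lt_of_mem hl)) h' rfl
    · obtain ⟨v', h'⟩ := h.exists_step_fixed hσ hB hsc hl hmin hll
      exact ih _ (Finset.card_erase_lt_of_mem hl) h' rfl

end FormReduced

/-- An admissible basis differs from the standard one only inside a finite coordinate subspace,
which may be chosen stable under a given involution. -/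
theorem IsAdmBasis.exists_finset {v : ℕ → ℕ →₀ ℂ} (hv : IsAdmBasis v) {ι₀ : ℕ → ℕ}
    (hι₀ : ∀ k, ι₀ (ι₀ k) = k) :
    ∃ F : Finset ℕ, (∀ k ∈ F, ι₀ k ∈ F) ∧ (∀ k ∉ F, v k = eB k) ∧
      ∀ k ∈ F, v k ∈ Submodule.span ℂ (eB '' F) := by
  classical
  obtain ⟨F₀, hF₀⟩ : ∃ F₀ : Finset ℕ, F₀ = hv.2.2.toFinset ∪
    hv.2.2.toFinset.biUnion fun k => (v k).support := ⟨_, rfl⟩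
  have hout : ∀ k ∉ F₀, v k = eB k := by
    intro k hk
    by_contra hne
    exact hk (by rw [hF₀]; exact Finset.mem_union_left _ (by simpa using hne))
  have hsub : F₀ ⊆ F₀ ∪ F₀.image ι₀ := Finset.subset_union_left
  refine ⟨F₀ ∪ F₀.image ι₀, ?_, fun k hk => hout k fun h => hk (hsub h), fun k hk => ?_⟩
  · intro k hk
    rcases Finset.mem_union.1 hk with h | h
    · exact Finset.mem_union_right _ (Finset.mem_image_of_mem _ h)
    · obtain ⟨j, hj, rfl⟩ := Finset.mem_image.1 h
      rw [hι₀]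
      exact hsub hj
  · by_cases hne : v k = eB k
    · rw [hne]
      exact Submodule.subset_span ⟨k, hk, rfl⟩
    · have hsupp : (v k).support ⊆ F₀ := by
        rw [hF₀]
        refine Finset.Subset.trans ?_ Finset.subset_union_right
        exact Finset.subset_biUnion_of_mem (fun k => (v k).support) (by simpa using hne)
      rw [← (v k).sum_single]
      refine Submodule.sum_mem _ fun j hj => ?_
      have : Finsupp.single j (v k j) = v k j • eB j := by simp [eB]
      rw [this]
      exact Submodule.smul_mem _ _ (Submodule.subset_span ⟨j, hsub (hsupp hj), rfl⟩)

theorem IsAdmBasis.exists_formReduced (hσ : Function.Injective σ) {v₀ : ℕ → ℕ →₀ ℂ}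
    (hv₀ : IsAdmBasis v₀) {B : (ℕ →₀ ℂ) →ₗ[ℂ] (ℕ →₀ ℂ) →ₛₗ[ρ] ℂ} {ι₀ : ℕ → ℕ} {η : ℂ}
    (hι₀ : ∀ k, ι₀ (ι₀ k) = k) (hη : η = 1 ∨ η = -1) (hB : ∀ x y, B x y = η * ρ (B y x))
    (hsc : ∀ x, B x x ≠ 0 → ∃ d, d * ρ d * B x x = 1) (hnd : ∀ x, (∀ y, B y x = 0) → x = 0)
    (hzero : ∀ k l, l ≠ ι₀ k → B (eB l) (eB k) = 0)
    (hpm : ∀ k, B (eB (ι₀ k)) (eB k) = 1 ∨ B (eB (ι₀ k)) (eB k) = -1) :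
    ∃ w v, FormReduced σ B ι₀ v₀ ∅ w v := by
  obtain ⟨F, hF, hout, hin⟩ := hv₀.exists_finset hι₀
  have hF' : ∀ k ∉ F, ι₀ k ∉ F := fun k hk h => hk (hι₀ k ▸ hF _ h)
  refine FormReduced.exists_empty (T := F) (v := v₀) (w := fun k => if k ∈ F then k else ι₀ k)
    hσ hη hB hsc hnd ⟨hv₀, fun a => ⟨rfl, rfl⟩, ?_, ?_, ?_, ?_, ?_⟩
  · intro k
    by_cases hk : k ∈ F
    · simp [hk]
    · simp [hk, hF' k hk, hι₀]
  · refine F.finite_toSet.subset fun k hk => ?_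
    by_contra h
    exact hk (if_neg h)
  · intro k hk
    exact if_pos hk
  · intro k hk l hl
    rw [if_neg hk] at hl
    rw [hout k hk]
    by_cases hlF : l ∈ F
    · have := hin l hlF
      generalize v₀ l = x at this
      induction this using Submodule.span_induction with
      | mem x hx =>
        obtain ⟨j, hj, rfl⟩ := hx
        exact hzero k j fun h => hF' k hk (h ▸ hj)
      | zero => simp
      | add x y _ _ hx hy => rw [map_add, LinearMap.add_apply, hx, hy, add_zero]
      | smul c x _ hx => rw [map_smul, LinearMap.smul_apply, hx, smul_zero]
    · rw [hout l hlF, hzero k l hl]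
  · intro k hk
    rw [if_neg hk, hout _ (hF' k hk), hout k hk]
    exact hpm k

end FormElimination

section ConjElimination

variable {A : Type*} [LinearOrder A] {σ : ℕ → A}

/-- `v` spans the same flag as `v₀`, and `γ` permutes, up to signs and according to the
involution `w`, the vectors of `v` with index outside `T`, and stabilizes the span of the others. -/
structure ConjReduced (σ : ℕ → A) (ε : ℂ) (ι : ℕ → ℕ)
    (v₀ : ℕ → ℕ →₀ ℂ) (T : Finset ℕ) (w : ℕ → ℕ) (v : ℕ → ℕ →₀ ℂ) : Prop where
  adm : IsAdmBasis v
  flag : SameFlag σ v₀ v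
  invol : ∀ k, w (w k) = k
  fin : {k | w k ≠ ι k}.Finite
  fix : ∀ k ∈ T, w k = k
  pm : ∀ k ∉ T, gammaMap ε ι (v k) = v (w k) ∨ gammaMap ε ι (v k) = -v (w k)
  stable : ∀ k ∈ T, gammaMap ε ι (v k) ∈ Submodule.span ℂ (v '' T)

namespace ConjReduced

variable {ε : ℂ} {ι : ℕ → ℕ} {v₀ : ℕ → ℕ →₀ ℂ} {T : Finset ℕ} {w : ℕ → ℕ} {v : ℕ → ℕ →₀ ℂ}

theorem apply_notMem (h : ConjReduced σ ε ι v₀ T w v) {k : ℕ} (hk : k ∉ T) : w k ∉ T :=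
  fun hw => hk (by have := h.fix _ hw; rw [h.invol] at this; rwa [this])

theorem exists_step_fixed (hσ : Function.Injective σ) (h : ConjReduced σ ε ι v₀ T w v)
    (hε : ε = 1 ∨ ε = -1) (hγ : ∀ x, gammaMap ε ι (gammaMap ε ι x) = ε • x)
    {l : ℕ} (hl : l ∈ T) (hmin : ∀ k ∈ T, σ l ≤ σ k) {c : ℂ}
    (hc : gammaMap ε ι (v l) = c • v l) :
    ∃ v', ConjReduced σ ε ι v₀ (T.erase l) w v' := by
  have hlt : ∀ k ∈ T, k ≠ l → σ l < σ k := fun k hk hkl =>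
    lt_of_le_of_ne (hmin k hk) fun h' => hkl (hσ h').symm
  have hcε : (Complex.normSq c : ℂ) = ε := by
    have h1 := hγ (v l)
    rw [hc, map_smulₛₗ, hc, smul_smul] at h1
    rw [← smul_left_injective ℂ (h.adm.1.ne_zero l) h1, ← Complex.mul_conj, mul_comm]
  have hε1 : ε = 1 := by
    refine hε.resolve_right fun h' => ?_
    rw [h'] at hcε
    have h2 : Complex.normSq c = -1 := by exact_mod_cast hcε
    linarith [Complex.normSq_nonneg c]
  subst hε1
  obtain ⟨d, hd⟩ := IsAlgClosed.exists_pow_nat_eq c (n := 2) two_pos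
  have hdn : Complex.normSq d = 1 := by
    have h1 : Complex.normSq c = 1 := by exact_mod_cast hcε
    rw [← hd, map_pow] at h1
    exact (pow_eq_one_iff_of_nonneg (Complex.normSq_nonneg d) two_ne_zero).1 h1
  have hd0 : d ≠ 0 := by rintro rfl; simp at hdn
  have hdc : starRingEnd ℂ d * c = d := by
    have h2 : d * starRingEnd ℂ d = 1 := by rw [Complex.mul_conj, hdn, Complex.ofReal_one]
    rw [← hd]
    linear_combination d * h2
  obtain ⟨u, hu⟩ : ∃ u, u = d • v l := ⟨_, rfl⟩
  have hγu : gammaMap 1 ι u = u := by rw [hu, map_smulₛₗ, hc, smul_smul, hdc]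
  have hvl : v l = d⁻¹ • u := by rw [hu, smul_smul, inv_mul_cancel₀ hd0, one_smul]
  obtain ⟨f, hf⟩ : ∃ f : (ℕ →₀ ℂ) →ₗ[ℂ] ℂ, f u = 1 := by
    refine ⟨d⁻¹ • h.adm.basis.coord l, ?_⟩
    have : h.adm.basis.coord l (v l) = 1 := by
      rw [← h.adm.basis_apply l, Module.Basis.coord_apply, Module.Basis.repr_self]
      simp
    rw [hu, LinearMap.smul_apply, map_smul, this, smul_eq_mul, smul_eq_mul, mul_one,
      inv_mul_cancel₀ hd0]
  obtain ⟨φ, hφ⟩ : ∃ φ : (ℕ →₀ ℂ) →ₗ[ℂ] ℂ,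
      ∀ x, φ x = (f x + starRingEnd ℂ (f (gammaMap 1 ι x))) / 2 :=
    ⟨{ toFun := fun x => (f x + starRingEnd ℂ (f (gammaMap 1 ι x))) / 2
       map_add' := fun x y => by simp only [map_add]; ring
       map_smul' := fun a x => by
        simp only [map_smul, map_smulₛₗ, smul_eq_mul, map_mul, Complex.conj_conj,
          RingHom.id_apply]
        ring }, fun _ => rfl⟩
  have hφu : φ u = 1 := by rw [hφ, hγu, hf, map_one]; norm_num
  have hφγ : ∀ x, φ (gammaMap 1 ι x) = starRingEnd ℂ (φ x) := fun x => by
    rw [hφ, hφ, hγ, one_smul, map_div₀, map_add, Complex.conj_conj, map_ofNat, add_comm]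
  obtain ⟨v', hv'⟩ : ∃ v' : ℕ → ℕ →₀ ℂ, v' = fun k => if k = l then u else
      if k ∈ T then v k - φ (v k) • u else v k := ⟨_, rfl⟩
  have hv'l : v' l = u := by simp [hv']
  have hv'T : ∀ k ∈ T, k ≠ l → v' k = v k - φ (v k) • u := by
    intro k hk hkl; simp [hv', hk, hkl]
  have hv'n : ∀ k ∉ T, v' k = v k := by
    intro k hk
    have : k ≠ l := by rintro rfl; exact hk hl
    simp [hv', hk, this]
  have htri : SameFlag σ v v' := by
    refine sameFlag_of_triangular fun k => ?_
    by_cases hkl : k = l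
    · subst hkl
      exact ⟨d, hd0, 0, zero_mem _, by rw [hv'l, add_zero, hu]⟩
    by_cases hk : k ∈ T
    · refine ⟨1, one_ne_zero, -(φ (v k) • u), ⟨?_, ?_⟩, ?_⟩
      · rw [hu]
        exact neg_mem (Submodule.smul_mem _ _ (Submodule.smul_mem _ _ (mem_flagLT (hlt k hk hkl))))
      · rw [← hv'l]
        exact neg_mem (Submodule.smul_mem _ _ (mem_flagLT (hlt k hk hkl)))
      · rw [hv'T k hk hkl, one_smul, sub_eq_add_neg]
    · exact ⟨1, one_ne_zero, 0, zero_mem _, by rw [hv'n k hk, one_smul, add_zero]⟩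
  have hφ0 : ∀ k ∈ T.erase l, φ (v' k) = 0 := fun k hk => by
    rw [hv'T k (Finset.mem_of_mem_erase hk) (Finset.ne_of_mem_erase hk), map_sub, map_smul, hφu,
      smul_eq_mul, mul_one, sub_self]
  have hspan : Submodule.span ℂ (v '' T) ≤ Submodule.span ℂ (v' '' T) := by
    rw [Submodule.span_le]
    rintro _ ⟨k, hk, rfl⟩
    have hu' : u ∈ Submodule.span ℂ (v' '' T) := Submodule.subset_span ⟨l, hl, hv'l⟩
    by_cases hkl : k = l
    · rw [hkl, hvl]
      exact Submodule.smul_mem _ _ hu'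
    · have : v k = v' k + φ (v k) • u := by rw [hv'T k hk hkl, sub_add_cancel]
      rw [this]
      exact add_mem (Submodule.subset_span ⟨k, hk, rfl⟩) (Submodule.smul_mem _ _ hu')
  have hstab : ∀ x ∈ Submodule.span ℂ (v' '' T), φ x = 0 →
      x ∈ Submodule.span ℂ (v' '' (T.erase l : Finset ℕ)) := by
    intro x hx hx0
    rw [← Finset.insert_erase hl, Finset.coe_insert, Set.image_insert_eq,
      Submodule.mem_span_insert, hv'l] at hx
    obtain ⟨a, z, hz, rfl⟩ := hx
    have hz0 : φ z = 0 := by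
      have : Submodule.span ℂ (v' '' (T.erase l : Finset ℕ)) ≤ LinearMap.ker φ := by
        rw [Submodule.span_le]
        rintro _ ⟨k, hk, rfl⟩
        exact hφ0 k hk
      exact this hz
    rw [map_add, map_smul, hφu, hz0, smul_eq_mul, mul_one, add_zero] at hx0
    rwa [hx0, zero_smul, zero_add]
  refine ⟨v', htri.isAdmBasis h.adm ?_, h.flag.trans htri, h.invol, h.fin,
    fun k hk => h.fix k (Finset.mem_of_mem_erase hk), ?_, ?_⟩
  · refine T.finite_toSet.subset fun k hk => ?_
    by_contra hkT
    exact hk (hv'n k hkT)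
  · intro k hk
    by_cases hkl : k = l
    · subst hkl
      rw [h.fix _ hl, hv'l]
      exact Or.inl hγu
    · have hkT : k ∉ T := fun h' => hk (Finset.mem_erase.2 ⟨hkl, h'⟩)
      rw [hv'n k hkT, hv'n _ (h.apply_notMem hkT)]
      exact h.pm k hkT
  · intro k hk
    refine hstab _ (hspan ?_) (by rw [hφγ, hφ0 k hk, map_zero])
    rw [hv'T k (Finset.mem_of_mem_erase hk) (Finset.ne_of_mem_erase hk), map_sub, map_smulₛₗ, hγu,
      hu]
    exact sub_mem (h.stable k (Finset.mem_of_mem_erase hk))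
      (Submodule.smul_mem _ _ (Submodule.smul_mem _ _ (Submodule.subset_span ⟨l, hl, rfl⟩)))

theorem exists_step_swap (hσ : Function.Injective σ) (h : ConjReduced σ ε ι v₀ T w v)
    (hε : ε = 1 ∨ ε = -1) (hγ : ∀ x, gammaMap ε ι (gammaMap ε ι x) = ε • x)
    {l m : ℕ} (hl : l ∈ T) (hmin : ∀ k ∈ T, σ l ≤ σ k) (hm : m ∈ T) (hlm : l ≠ m) {a : ℕ → ℂ}
    (ha : gammaMap ε ι (v l) = ∑ k ∈ T, a k • v k) (ham : a m ≠ 0)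
    (hmax : ∀ k ∈ T, a k ≠ 0 → σ k ≤ σ m) :
    ∃ w' v', ConjReduced σ ε ι v₀ ((T.erase l).erase m) w' v' := by
  have hlt : ∀ k ∈ T, k ≠ l → σ l < σ k := fun k hk hkl =>
    lt_of_le_of_ne (hmin k hk) fun h' => hkl (hσ h').symm
  obtain ⟨p, hp⟩ : ∃ p, p = gammaMap ε ι (v l) := ⟨_, rfl⟩
  have hγp : gammaMap ε ι p = ε • v l := by rw [hp, hγ]
  obtain ⟨y, hy⟩ : ∃ y, y = ∑ k ∈ T.erase m, a k • v k := ⟨_, rfl⟩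
  have hpy : p = a m • v m + y := by
    rw [hp, ha, hy, Finset.add_sum_erase T (fun k => a k • v k) hm]
  have hymem : ∀ u : ℕ → ℕ →₀ ℂ, (∀ k ∈ T.erase m, u k = v k) → y ∈ flagLT σ u (σ m) := by
    intro u hu
    rw [hy]
    refine Submodule.sum_mem _ fun k hk => ?_
    by_cases hak : a k = 0
    · rw [hak, zero_smul]; exact zero_mem _
    · rw [← hu k hk]
      refine Submodule.smul_mem _ _ (mem_flagLT (lt_of_le_of_ne
        (hmax k (Finset.mem_of_mem_erase hk) hak) fun h' => ?_))
      exact Finset.ne_of_mem_erase hk (hσ h')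
  obtain ⟨v₁, hv₁⟩ : ∃ v₁ : ℕ → ℕ →₀ ℂ, v₁ = Function.update v m p := ⟨_, rfl⟩
  have hv₁m : v₁ m = p := by simp [hv₁]
  have hv₁n : ∀ k, k ≠ m → v₁ k = v k := fun k hk => by simp [hv₁, hk]
  have htri₁ : SameFlag σ v v₁ := by
    refine sameFlag_of_triangular fun k => ?_
    by_cases hkm : k = m
    · subst hkm
      exact ⟨a k, ham, y, ⟨hymem v fun _ _ => rfl,
        hymem v₁ fun j hj => hv₁n j (Finset.ne_of_mem_erase hj)⟩, by rw [hv₁m, hpy]⟩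
    · exact ⟨1, one_ne_zero, 0, zero_mem _, by rw [hv₁n k hkm, one_smul, add_zero]⟩
  have hadm₁ : IsAdmBasis v₁ := by
    refine htri₁.isAdmBasis h.adm ((Set.finite_singleton m).subset fun k hk => ?_)
    by_contra hkm
    exact hk (hv₁n k hkm)
  obtain ⟨f, hfm, hfn⟩ : ∃ f : (ℕ →₀ ℂ) →ₗ[ℂ] ℂ, f p = 1 ∧ ∀ k, k ≠ m → f (v k) = 0 := by
    refine ⟨hadm₁.basis.coord m, ?_, fun k hk => ?_⟩
    · rw [← hv₁m, ← hadm₁.basis_apply m, Module.Basis.coord_apply, Module.Basis.repr_self]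
      simp
    · rw [← hv₁n k hk, ← hadm₁.basis_apply k, Module.Basis.coord_apply, Module.Basis.repr_self]
      simp [hk]
  have hfγl : f (gammaMap ε ι (v l)) = 1 := by rw [← hp, hfm]
  have hfγp : f (gammaMap ε ι p) = 0 := by rw [hγp, map_smul, hfn l hlm, smul_zero]
  obtain ⟨v', hv'⟩ : ∃ v' : ℕ → ℕ →₀ ℂ, v' = fun k => if k = m then p else
      if k ∈ T.erase l then v k - starRingEnd ℂ (f (gammaMap ε ι (v k))) • v l else v k :=
    ⟨_, rfl⟩
  have hv'm : v' m = p := by simp [hv']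
  have hv'l : v' l = v l := by simp [hv', hlm]
  have hv'T : ∀ k ∈ T, k ≠ l → k ≠ m →
      v' k = v k - starRingEnd ℂ (f (gammaMap ε ι (v k))) • v l := by
    intro k hk hkl hkm; simp [hv', hk, hkl, hkm]
  have hv'n : ∀ k ∉ T, v' k = v k := by
    intro k hk
    have : k ≠ m := by rintro rfl; exact hk hm
    simp [hv', hk, this]
  have hT : ∀ k, k = l ∨ k = m ∨ (k ∈ T ∧ k ≠ l ∧ k ≠ m) ∨ k ∉ T := by
    intro k; tauto
  have htri : SameFlag σ v₁ v' := by
    refine sameFlag_of_triangular fun k => ?_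
    rcases hT k with rfl | rfl | ⟨hk, hkl, hkm⟩ | hk
    · exact ⟨1, one_ne_zero, 0, zero_mem _, by rw [hv'l, hv₁n _ hlm, one_smul, add_zero]⟩
    · exact ⟨1, one_ne_zero, 0, zero_mem _, by rw [hv'm, hv₁m, one_smul, add_zero]⟩
    · refine ⟨1, one_ne_zero, -(starRingEnd ℂ (f (gammaMap ε ι (v k))) • v l), ⟨?_, ?_⟩, ?_⟩
      · rw [← hv₁n l hlm]
        exact neg_mem (Submodule.smul_mem _ _ (mem_flagLT (hlt k hk hkl)))
      · rw [← hv'l]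
        exact neg_mem (Submodule.smul_mem _ _ (mem_flagLT (hlt k hk hkl)))
      · rw [hv'T k hk hkl hkm, hv₁n k hkm, one_smul, sub_eq_add_neg]
    · have hkm : k ≠ m := by rintro rfl; exact hk hm
      exact ⟨1, one_ne_zero, 0, zero_mem _, by rw [hv'n k hk, hv₁n k hkm, one_smul, add_zero]⟩
  have htri' : SameFlag σ v v' := htri₁.trans htri
  have hT' : ∀ k ∈ (T.erase l).erase m, k ∈ T ∧ k ≠ l ∧ k ≠ m := by
    intro k hk
    simp only [Finset.mem_erase] at hk
    tauto
  have hf0 : ∀ k ∈ (T.erase l).erase m, f (v' k) = 0 := by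
    intro k hk
    obtain ⟨hk, hkl, hkm⟩ := hT' k hk
    rw [hv'T k hk hkl hkm, map_sub, map_smul, hfn k hkm, hfn l hlm, smul_zero, sub_zero]
  have hfγ0 : ∀ k ∈ (T.erase l).erase m, f (gammaMap ε ι (v' k)) = 0 := by
    intro k hk
    obtain ⟨hk, hkl, hkm⟩ := hT' k hk
    rw [hv'T k hk hkl hkm, map_sub, map_smulₛₗ, Complex.conj_conj, map_sub, map_smul, hfγl,
      smul_eq_mul, mul_one, sub_self]
  have hspan : Submodule.span ℂ (v '' T) ≤ Submodule.span ℂ (v' '' T) := by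
    have hvl : v l ∈ Submodule.span ℂ (v' '' T) := Submodule.subset_span ⟨l, hl, hv'l⟩
    have hvk : ∀ k ∈ T.erase m, v k ∈ Submodule.span ℂ (v' '' T) := by
      intro k hk
      by_cases hkl : k = l
      · rwa [hkl]
      · have hkT := Finset.mem_of_mem_erase hk
        rw [← sub_add_cancel (v k) (starRingEnd ℂ (f (gammaMap ε ι (v k))) • v l),
          ← hv'T k hkT hkl (Finset.ne_of_mem_erase hk)]
        exact add_mem (Submodule.subset_span ⟨k, hkT, rfl⟩) (Submodule.smul_mem _ _ hvl)
    rw [Submodule.span_le]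
    rintro _ ⟨k, hk, rfl⟩
    by_cases hkm : k = m
    · have : v m = (a m)⁻¹ • (p - y) := by
        rw [hpy, add_sub_cancel_right, smul_smul, inv_mul_cancel₀ ham, one_smul]
      rw [hkm, this]
      refine Submodule.smul_mem _ _ (sub_mem (Submodule.subset_span ⟨m, hm, hv'm⟩) ?_)
      rw [hy]
      exact Submodule.sum_mem _ fun j hj => Submodule.smul_mem _ _ (hvk j hj)
    · exact hvk k (Finset.mem_erase.2 ⟨hkm, hk⟩)
  have hstab : ∀ x ∈ Submodule.span ℂ (v' '' T), f x = 0 → f (gammaMap ε ι x) = 0 →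
      x ∈ Submodule.span ℂ (v' '' ((T.erase l).erase m : Finset ℕ)) := by
    intro x hx hx0 hx1
    rw [← Finset.insert_erase hl, ← Finset.insert_erase (Finset.mem_erase.2 ⟨hlm.symm, hm⟩),
      Finset.coe_insert, Finset.coe_insert, Set.image_insert_eq, Set.image_insert_eq,
      Submodule.mem_span_insert, hv'l] at hx
    obtain ⟨b, x', hx', rfl⟩ := hx
    rw [Submodule.mem_span_insert, hv'm] at hx'
    obtain ⟨b', z, hz, rfl⟩ := hx'
    have hz0 : f z = 0 ∧ f (gammaMap ε ι z) = 0 := by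
      clear hx0 hx1
      induction hz using Submodule.span_induction with
      | mem x hx =>
        obtain ⟨k, hk, rfl⟩ := hx
        exact ⟨hf0 k hk, hfγ0 k hk⟩
      | zero => simp
      | add x y _ _ hx hy => simp only [map_add, hx, hy, add_zero, and_self]
      | smul c x _ hx => simp only [map_smulₛₗ, hx, smul_zero, and_self]
    rw [map_add, map_add, map_smul, map_smul, hfn l hlm, hfm, hz0.1, smul_zero, zero_add, add_zero,
      smul_eq_mul, mul_one] at hx0
    rw [hx0, zero_smul, zero_add, map_add, map_add, map_smulₛₗ, map_smul, hfγl, hz0.2, add_zero,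
      smul_eq_mul, mul_one, map_eq_zero_iff _ (starRingEnd ℂ).injective] at hx1
    rwa [hx0, hx1, zero_smul, zero_smul, zero_add, zero_add]
  obtain ⟨w', hw'⟩ : ∃ w' : ℕ → ℕ, w' = fun k => if k = l then m else if k = m then l else w k :=
    ⟨_, rfl⟩
  have hw'l : w' l = m := by simp [hw']
  have hw'm : w' m = l := by simp [hw', hlm.symm]
  have hw'n : ∀ k, k ≠ l → k ≠ m → w' k = w k := fun k h1 h2 => by simp [hw', h1, h2]
  have hw'T : ∀ k ∉ T, w' k = w k := fun k hk =>
    hw'n k (by rintro rfl; exact hk hl) (by rintro rfl; exact hk hm)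
  refine ⟨w', v', htri'.isAdmBasis h.adm ?_, h.flag.trans htri', ?_, ?_, ?_, ?_, ?_⟩
  · refine T.finite_toSet.subset fun k hk => ?_
    by_contra hkT
    exact hk (hv'n k hkT)
  · intro k
    rcases hT k with rfl | rfl | ⟨hk, hkl, hkm⟩ | hk
    · rw [hw'l, hw'm]
    · rw [hw'm, hw'l]
    · rw [hw'n k hkl hkm, h.fix k hk, hw'n k hkl hkm, h.fix k hk]
    · rw [hw'T k hk, hw'T _ (h.apply_notMem hk), h.invol]
  · refine (h.fin.union (Set.toFinite {l, m})).subset fun k hk => ?_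
    by_contra hcon
    simp only [Set.mem_union, Set.mem_ofPred_eq, not_or, not_not, Set.mem_insert_iff,
      Set.mem_singleton_iff] at hcon
    exact hk (by rw [hw'n k hcon.2.1 hcon.2.2, hcon.1])
  · intro k hk
    obtain ⟨hk, hkl, hkm⟩ := hT' k hk
    rw [hw'n k hkl hkm, h.fix k hk]
  · intro k hk
    simp only [Finset.mem_erase] at hk
    rcases hT k with rfl | rfl | hkT | hkT
    · rw [hw'l, hv'l, hv'm]; exact Or.inl hp.symm
    · rw [hw'm, hv'l, hv'm, hγp]
      rcases hε with rfl | rfl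
      · exact Or.inl (one_smul _ _)
      · exact Or.inr (by rw [neg_smul, one_smul])
    · tauto
    · rw [hw'T k hkT, hv'n k hkT, hv'n _ (h.apply_notMem hkT)]
      exact h.pm k hkT
  · intro k hk
    refine hstab _ (hspan ?_) (hfγ0 k hk) (by rw [hγ, map_smul, hf0 k hk, smul_zero])
    obtain ⟨hk, hkl, hkm⟩ := hT' k hk
    rw [hv'T k hk hkl hkm, map_sub, map_smulₛₗ]
    exact sub_mem (h.stable k hk) (Submodule.smul_mem _ _ (h.stable l hl))

theorem exists_empty (hσ : Function.Injective σ) (hε : ε = 1 ∨ ε = -1)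
    (hγ : ∀ x, gammaMap ε ι (gammaMap ε ι x) = ε • x) (h : ConjReduced σ ε ι v₀ T w v) :
    ∃ w' v', ConjReduced σ ε ι v₀ ∅ w' v' := by
  induction hn : T.card using Nat.strong_induction_on generalizing T w v with
  | _ n ih =>
    subst hn
    rcases T.eq_empty_or_nonempty with rfl | hT
    · exact ⟨w, v, h⟩
    obtain ⟨l, hl, hmin⟩ := T.exists_min_image σ hT
    obtain ⟨a, ha⟩ := Submodule.mem_span_image_finset_iff_exists_fun' ℂ |>.1 (h.stable l hl)
    have hne : (T.filter fun k => a k ≠ 0).Nonempty := by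
      by_contra hcon
      rw [Finset.not_nonempty_iff_eq_empty, Finset.filter_eq_empty_iff] at hcon
      have h0 : gammaMap ε ι (v l) = 0 := by
        rw [← ha]
        exact Finset.sum_eq_zero fun k hk => by
          have : a k = 0 := by simpa using hcon hk
          rw [this, zero_smul]
      have h1 := hγ (v l)
      rw [h0, map_zero, eq_comm, smul_eq_zero] at h1
      rcases h1 with h1 | h1
      · rw [h1] at hε; norm_num at hε
      · exact h.adm.1.ne_zero l h1
    obtain ⟨m, hm, hmax⟩ := Finset.exists_max_image _ σ hne
    rw [Finset.mem_filter] at hm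
    replace hmax : ∀ k ∈ T, a k ≠ 0 → σ k ≤ σ m := fun k hk hk' =>
      hmax k (Finset.mem_filter.2 ⟨hk, hk'⟩)
    by_cases hlm : l = m
    · subst hlm
      have hc : gammaMap ε ι (v l) = a l • v l := by
        rw [← ha]
        refine Finset.sum_eq_single_of_mem l hl fun k hk hkl => ?_
        have : a k = 0 := by
          by_contra hak
          exact hkl (hσ (le_antisymm (hmax k hk hak) (hmin k hk)))
        rw [this, zero_smul]
      obtain ⟨v', h'⟩ := h.exists_step_fixed hσ hε hγ hl hmin hc
      exact ih _ (Finset.card_erase_lt_of_mem hl) h' rfl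
    · obtain ⟨w', v', h'⟩ := h.exists_step_swap hσ hε hγ hl hmin hm.1 hlm ha.symm hm.2 hmax
      exact ih _ ((Finset.card_le_card (Finset.erase_subset _ _)).trans_lt
        (Finset.card_erase_lt_of_mem hl)) h' rfl

end ConjReduced

theorem IsAdmBasis.exists_conjReduced (hσ : Function.Injective σ) {v₀ : ℕ → ℕ →₀ ℂ}
    (hv₀ : IsAdmBasis v₀) {ε : ℂ} {ι : ℕ → ℕ} (hι : ∀ k, ι (ι k) = k)
    (htype : ε = 1 ∨ (ε = -1 ∧ ∀ l, ι l ≠ l)) :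
    ∃ w v, ConjReduced σ ε ι v₀ ∅ w v := by
  obtain ⟨F, hF, hout, hin⟩ := hv₀.exists_finset hι
  have hF' : ∀ k ∉ F, ι k ∉ F := fun k hk h => hk (hι k ▸ hF _ h)
  have hspan : Submodule.span ℂ (v₀ '' F) = Submodule.span ℂ (eB '' F) := by
    refine span_image_eq_of_subset isAdmBasis_eB hv₀ ?_
    rw [Submodule.span_le]
    rintro _ ⟨k, hk, rfl⟩
    exact hin k hk
  refine ConjReduced.exists_empty (T := F) (v := v₀) (w := fun k => if k ∈ F then k else ι k)
    hσ (eps_eq htype) (gammaInf_gammaInf hι htype)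
    ⟨hv₀, fun a => ⟨rfl, rfl⟩, ?_, ?_, ?_, ?_, ?_⟩
  · intro k
    by_cases hk : k ∈ F
    · simp [hk]
    · simp [hk, hF' k hk, hι]
  · refine F.finite_toSet.subset fun k hk => ?_
    by_contra h
    exact hk (if_neg h)
  · intro k hk
    exact if_pos hk
  · intro k hk
    rw [if_neg hk, hout k hk, hout _ (hF' k hk), gammaMap_apply, gammaInf_eB hι]
    rcases omegaSign_eq (ι := ι) (eps_eq htype) (ι k) with h | h <;> rw [h] <;> simp
  · intro k hk
    rw [hspan]
    have := hin k hk
    generalize v₀ k = x at this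
    induction this using Submodule.span_induction with
    | mem x hx =>
      obtain ⟨j, hj, rfl⟩ := hx
      rw [gammaMap_apply, gammaInf_eB hι]
      exact Submodule.smul_mem _ _ (Submodule.subset_span ⟨ι j, hF j hj, rfl⟩)
    | zero => rw [map_zero]; exact zero_mem _
    | add x y _ _ hx hy => rw [map_add]; exact add_mem hx hy
    | smul c x _ hx => rw [map_smulₛₗ]; exact Submodule.smul_mem _ _ hx

end ConjElimination

theorem apply_eq_zero_of_mem_span {ρ : ℂ →+* ℂ} {M : Type*} [AddCommGroup M] [Module ℂ M]
    (f : (ℕ →₀ ℂ) →ₛₗ[ρ] M) {v : ℕ → ℕ →₀ ℂ} {I : Set ℕ} (h : ∀ k ∈ I, f (v k) = 0)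
    {x : ℕ →₀ ℂ} (hx : x ∈ Submodule.span ℂ (v '' I)) : f x = 0 := by
  have : Submodule.span ℂ (v '' I) ≤ LinearMap.ker f := by
    rw [Submodule.span_le]
    rintro _ ⟨k, hk, rfl⟩
    exact h k hk
  exact this hx

theorem IsAdmBasis.coord_self {v : ℕ → ℕ →₀ ℂ} (hv : IsAdmBasis v) (k : ℕ) :
    hv.basis.coord k (v k) = 1 := by
  rw [← hv.basis_apply k, Module.Basis.coord_apply, Module.Basis.repr_self]
  simp

theorem IsAdmBasis.coord_of_ne {v : ℕ → ℕ →₀ ℂ} (hv : IsAdmBasis v) {k l : ℕ} (h : k ≠ l) :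
    hv.basis.coord k (v l) = 0 := by
  rw [← hv.basis_apply l, Module.Basis.coord_apply, Module.Basis.repr_self]
  simp [h]

section Uniqueness

variable {A : Type*} [LinearOrder A] {σ : ℕ → A} {ε : ℂ} {ι w w' : ℕ → ℕ} {v v' : ℕ → ℕ →₀ ℂ}

theorem IsWDualInf.ne_zero (h : IsWDualInf ε ι w v) (k : ℕ) : omegaInf ε ι (v (w k)) (v k) ≠ 0 := by
  rcases (h k (w k)).2 rfl with h | h <;> rw [h] <;> simp

theorem IsWDualInf.le_of_sameFlag (hσ : Function.Injective σ) (hf : SameFlag σ v v')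
    (hv' : IsAdmBasis v') (hw : ∀ k, w (w k) = k) (h : IsWDualInf ε ι w v)
    (h' : IsWDualInf ε ι w' v') (l : ℕ) : σ (w' l) ≤ σ (w l) := by
  by_contra! hlt
  have hmem : v (w l) ∈ flagLT σ v' (σ (w' l)) := (hf _).1 ▸ mem_flagLT hlt
  have h0 : omegaBilin ε ι (v (w l)) (v' l) = 0 :=
    apply_eq_zero_of_mem_span ((omegaBilin ε ι).flip (v' l))
      (fun k hk => (h' l k).1 fun hkl => (ne_of_lt hk) (by rw [hkl])) hmem
  obtain ⟨c, hc, y, hy, hl⟩ := hf.symm.exists_eq hσ hv' l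
  have hy0 : omegaBilin ε ι (v (w l)) y = 0 :=
    apply_eq_zero_of_mem_span (omegaBilin ε ι (v (w l)))
      (fun k hk => (h k (w l)).1 fun hkl => (ne_of_lt hk) (by
        rw [← hw k, ← hkl, hw])) hy
  rw [hl, map_add, map_smul, hy0, add_zero, smul_eq_mul] at h0
  exact (mul_ne_zero hc (h.ne_zero l)) h0

theorem IsWConjInf.le_of_sameFlag (hσ : Function.Injective σ) (hf : SameFlag σ v v')
    (hv : IsAdmBasis v) (hv' : IsAdmBasis v') (hw : ∀ k, w (w k) = k) (h : IsWConjInf ε ι w v)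
    (h' : IsWConjInf ε ι w' v') (l : ℕ) : σ (w l) ≤ σ (w' l) := by
  by_contra! hlt
  have hmem : gammaMap ε ι (v' l) ∈ flagLE σ v (σ (w' l)) := by
    rw [(hf _).2]
    rcases h' l with h' | h' <;> rw [gammaMap_apply, h']
    · exact mem_flagLE le_rfl
    · exact neg_mem (mem_flagLE le_rfl)
  have h0 : hv.basis.coord (w l) (gammaMap ε ι (v' l)) = 0 :=
    apply_eq_zero_of_mem_span _ (fun k hk => hv.coord_of_ne fun hkl =>
      (hlt.trans_le' hk).ne (by rw [hkl])) hmem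
  obtain ⟨c, hc, y, hy, hl⟩ := hf.symm.exists_eq hσ hv' l
  have hy0 : hv.basis.coord (w l) (gammaMap ε ι y) = 0 := by
    refine apply_eq_zero_of_mem_span ((hv.basis.coord (w l)).comp (gammaMap ε ι))
      (fun k hk => ?_) hy
    have hkl : w l ≠ w k := fun hkl => (ne_of_lt hk) (by rw [← hw k, ← hkl, hw])
    rw [LinearMap.comp_apply]
    rcases h k with h | h <;> rw [gammaMap_apply, h]
    · exact hv.coord_of_ne hkl
    · rw [map_neg, hv.coord_of_ne hkl, neg_zero]
  have hl0 : hv.basis.coord (w l) (gammaMap ε ι (v l)) ≠ 0 := by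
    rcases h l with h | h <;> rw [gammaMap_apply, h]
    · rw [hv.coord_self]; exact one_ne_zero
    · rw [map_neg, hv.coord_self]; exact neg_ne_zero.2 one_ne_zero
  rw [hl, map_add, map_add, hy0, add_zero, map_smulₛₗ, map_smul, smul_eq_mul] at h0
  exact (mul_ne_zero ((map_ne_zero _).2 hc) hl0) h0

theorem OsetInf_inter_eq_empty (hσ : Function.Injective σ) (hw : ∀ k, w (w k) = k)
    (hw' : ∀ k, w' (w' k) = k) (hne : w ≠ w') : OsetInf σ ε ι w ∩ OsetInf σ ε ι w' = ∅ := by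
  rw [Set.eq_empty_iff_forall_notMem]
  rintro _ ⟨⟨v, hv, h, rfl⟩, v', hv', h', hS⟩
  have hf := sameFlag_of_flagSet_eq hv hv' hS
  exact hne (funext fun l => hσ (le_antisymm (h'.le_of_sameFlag hσ hf.symm hv hw' h l)
    (h.le_of_sameFlag hσ hf hv' hw h' l)))

theorem OOsetInf_inter_eq_empty (hσ : Function.Injective σ) (hw : ∀ k, w (w k) = k)
    (hw' : ∀ k, w' (w' k) = k) (hne : w ≠ w') : OOsetInf σ ε ι w ∩ OOsetInf σ ε ι w' = ∅ := by
  rw [Set.eq_empty_iff_forall_notMem]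
  rintro _ ⟨⟨v, hv, h, rfl⟩, v', hv', h', hS⟩
  have hf := sameFlag_of_flagSet_eq hv hv' hS
  exact hne (funext fun l => hσ (le_antisymm (h.le_of_sameFlag hσ hf hv hv' hw h' l)
    (h'.le_of_sameFlag hσ hf.symm hv' hv hw' h l)))

end Uniqueness

section Union

variable {A : Type*} [LinearOrder A] {σ : ℕ → A} {ε : ℂ} {ι : ℕ → ℕ}

theorem Xinf_eq_iUnion_OsetInf (hσ : Function.Injective σ) (hι : ∀ l, ι (ι l) = l)
    (htype : ε = 1 ∨ (ε = -1 ∧ ∀ l, ι l ≠ l)) :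
    Xinf σ = {S | ∃ w : ℕ → ℕ, InIinf ε ι w ∧ S ∈ OsetInf σ ε ι w} := by
  ext S
  constructor
  · rw [mem_Xinf]
    rintro ⟨v₀, hv₀, rfl⟩
    obtain ⟨w, v, h⟩ := hv₀.exists_formReduced hσ (B := omegaBilin ε ι) (η := ε) hι
      (eps_eq htype) (fun x y => omegaInf_symm hι htype x y)
      (fun x hx => by
        obtain ⟨d, hd⟩ := IsAlgClosed.exists_pow_nat_eq (omegaBilin ε ι x x)⁻¹ two_pos
        exact ⟨d, by rw [RingHom.id_apply, ← pow_two, hd, inv_mul_cancel₀ hx]⟩)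
      (fun x hx => eq_zero_of_omegaInf hι htype hx)
      (fun k l hkl => by
        rw [omegaBilin_apply, omegaInf_eB, if_neg]
        rintro rfl
        exact hkl (hι l).symm)
      (fun k => by
        rw [omegaBilin_apply, omegaInf_eB, hι, if_pos rfl]
        exact omegaSign_eq (eps_eq htype) _)
    refine ⟨w, ⟨h.invol, h.fin, ?_⟩, v, h.adm, ?_, h.flag.flagSet_eq⟩
    · rintro rfl k hk
      have h1 := h.pm k (Finset.notMem_empty k)
      have h2 := omegaInf_symm hι htype (v k) (v k)
      rw [hk, omegaBilin_apply] at h1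
      rcases h1 with h1 | h1 <;> rw [h1] at h2 <;> norm_num at h2
    · refine fun k l => ⟨h.zero k (Finset.notMem_empty k) l, ?_⟩
      rintro rfl
      exact h.pm k (Finset.notMem_empty k)
  · rintro ⟨w, -, v, hv, -, rfl⟩
    exact mem_Xinf.2 ⟨v, hv, rfl⟩

theorem Xinf_eq_iUnion_OOsetInf (hσ : Function.Injective σ) (hι : ∀ l, ι (ι l) = l)
    (htype : ε = 1 ∨ (ε = -1 ∧ ∀ l, ι l ≠ l)) :
    Xinf σ = {S | ∃ w : ℕ → ℕ, InIinf ε ι w ∧ S ∈ OOsetInf σ ε ι w} := by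
  ext S
  constructor
  · rw [mem_Xinf]
    rintro ⟨v₀, hv₀, rfl⟩
    obtain ⟨w, v, h⟩ := hv₀.exists_conjReduced hσ hι htype
    refine ⟨w, ⟨h.invol, h.fin, ?_⟩, v, h.adm, fun k => h.pm k (Finset.notMem_empty k),
      h.flag.flagSet_eq⟩
    rintro rfl k hk
    have h1 := h.pm k (Finset.notMem_empty k)
    have h2 : gammaMap (-1) ι (gammaMap (-1) ι (v k)) = (-1 : ℂ) • v k :=
      gammaInf_gammaInf hι htype (v k)
    have h3 : gammaMap (-1) ι (gammaMap (-1) ι (v k)) = v k := by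
      rw [hk] at h1
      rcases h1 with h1 | h1
      · rw [h1, h1]
      · rw [h1, map_neg, h1, neg_neg]
    rw [h3, neg_smul, one_smul, self_eq_neg] at h2
    exact h.adm.1.ne_zero k h2
  · rintro ⟨w, -, v, hv, -, rfl⟩
    exact mem_Xinf.2 ⟨v, hv, rfl⟩

end Union

section Orbits

variable {A : Type*} [LinearOrder A] {σ : ℕ → A} {ε : ℂ} {ι w : ℕ → ℕ} {v v' : ℕ → ℕ →₀ ℂ}

theorem exists_phases (hw : ∀ k, w (w k) = k) {r : ℕ → ℂ} (hr : ∀ k, r k = 1 ∨ r k = -1)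
    (hrw : ∀ k, r (w k) = r k) (hfin : {k | r k ≠ 1}.Finite) :
    ∃ c : ℕ → ℂ, (∀ k, c k * c (w k) = r k) ∧ (∀ k, c k * starRingEnd ℂ (c k) = 1) ∧
      {k | c k ≠ 1}.Finite := by
  refine ⟨fun k => if r k = 1 then 1 else if w k = k then Complex.I else
    if k < w k then -1 else 1, fun k => ?_, fun k => ?_, hfin.subset fun k hk h1 => hk (if_pos h1)⟩
  · simp only [hrw, hw]
    rcases hr k with h | h
    · simp [h]
    · have hn : ¬ (-1 : ℂ) = 1 := by norm_num
      rw [h, if_neg hn, if_neg hn]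
      rcases lt_trichotomy (w k) k with hlt | heq | hlt
      · rw [if_neg hlt.ne, if_neg hlt.not_gt, if_neg hlt.ne', if_pos hlt, one_mul]
      · rw [if_pos heq, if_pos heq.symm, Complex.I_mul_I]
      · rw [if_neg hlt.ne', if_pos hlt, if_neg hlt.ne, if_neg hlt.not_gt, mul_one]
  · beta_reduce
    split_ifs <;> simp

theorem sameFlag_smul {c : ℕ → ℂ} (hc : ∀ k, c k ≠ 0) (v : ℕ → ℕ →₀ ℂ) :
    SameFlag σ v fun k => c k • v k :=
  sameFlag_of_triangular fun k => ⟨c k, hc k, 0, zero_mem _, (add_zero _).symm⟩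

theorem IsAdmBasis.smul {c : ℕ → ℂ} (hc : ∀ k, c k ≠ 0) (hfin : {k | c k ≠ 1}.Finite)
    (hv : IsAdmBasis v) : IsAdmBasis fun k => c k • v k := by
  refine (sameFlag_smul (σ := id) hc v).isAdmBasis hv (hfin.subset fun k hk h => hk ?_)
  rw [h, one_smul]

theorem mem_KsetInf (hv : IsAdmBasis v) {g : (ℕ →₀ ℂ) →ₗ[ℂ] (ℕ →₀ ℂ)} (hg : g ∈ GEset)
    (h : ∀ k l, omegaInf ε ι (g (v l)) (g (v k)) = omegaInf ε ι (v l) (v k)) :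
    g ∈ KsetInf ε ι := by
  have : (omegaBilin ε ι).compl₁₂ g g = omegaBilin ε ι := by
    refine LinearMap.ext_basis hv.basis hv.basis fun l k => ?_
    rw [hv.basis_apply, hv.basis_apply]
    exact h k l
  exact ⟨hg, fun x y => LinearMap.congr_fun₂ this x y⟩

theorem mem_G0setInf (hv : IsAdmBasis v) {g : (ℕ →₀ ℂ) →ₗ[ℂ] (ℕ →₀ ℂ)} (hg : g ∈ GEset)
    (h : ∀ l, gammaInf ε ι (g (v l)) = g (gammaInf ε ι (v l))) : g ∈ G0setInf ε ι := by
  have : (gammaMap ε ι).comp g = g.comp (gammaMap ε ι) := by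
    refine hv.basis.ext fun l => ?_
    rw [hv.basis_apply]
    exact h l
  exact ⟨hg, fun x => LinearMap.congr_fun this x⟩

/-- `γ (v k) = t k • v (w k)` with signs `t k`. -/
def ConjSigns (ε : ℂ) (ι w : ℕ → ℕ) (v : ℕ → ℕ →₀ ℂ) (t : ℕ → ℂ) : Prop :=
  ∀ k, (t k = 1 ∨ t k = -1) ∧ gammaMap ε ι (v k) = t k • v (w k)

theorem IsWConjInf.exists_signs (h : IsWConjInf ε ι w v) : ∃ t, ConjSigns ε ι w v t := by
  have : ∀ k, ∃ t : ℂ, (t = 1 ∨ t = -1) ∧ gammaMap ε ι (v k) = t • v (w k) := fun k => by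
    rcases h k with h | h
    · exact ⟨1, Or.inl rfl, by rw [gammaMap_apply, h, one_smul]⟩
    · exact ⟨-1, Or.inr rfl, by rw [gammaMap_apply, h, neg_smul, one_smul]⟩
  choose t ht using this
  exact ⟨t, ht⟩

theorem pmOne_mul_self {t : ℂ} (h : t = 1 ∨ t = -1) : t * t = 1 := by
  rcases h with rfl | rfl <;> norm_num

theorem pmOne_mul {s t : ℂ} (hs : s = 1 ∨ s = -1) (ht : t = 1 ∨ t = -1) :
    s * t = 1 ∨ s * t = -1 := by
  rcases hs with rfl | rfl <;> rcases ht with rfl | rfl <;> norm_num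

theorem finite_ne_or_ne_comp (hw : ∀ k, w (w k) = k) (hv : IsAdmBasis v) (hv' : IsAdmBasis v') :
    {k | v k ≠ v' k ∨ v (w k) ≠ v' (w k)}.Finite := by
  have h1 : {k | v k ≠ v' k}.Finite := (hv.2.2.union hv'.2.2).subset fun k hk => by
    by_contra hcon
    simp only [Set.mem_union, Set.mem_ofPred_eq, not_or, not_not] at hcon
    exact hk (by rw [hcon.1, hcon.2])
  exact h1.union (h1.preimage (Function.Involutive.injective hw).injOn)

theorem ConjSigns.mul_comp (hι : ∀ l, ι (ι l) = l) (htype : ε = 1 ∨ (ε = -1 ∧ ∀ l, ι l ≠ l))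
    (hw : ∀ k, w (w k) = k) (hv : IsAdmBasis v) {t : ℕ → ℂ} (ht : ConjSigns ε ι w v t) (k : ℕ) :
    t k * t (w k) = ε := by
  have h1 : gammaMap ε ι (gammaMap ε ι (v k)) = ε • v k := gammaInf_gammaInf hι htype (v k)
  have h2 : starRingEnd ℂ (t k) = t k := by rcases (ht k).1 with h | h <;> simp [h]
  rw [(ht k).2, map_smulₛₗ, (ht (w k)).2, hw, h2, smul_smul] at h1
  exact smul_left_injective ℂ (hv.1.ne_zero k) h1

theorem IsWDualInf.exists_phases (hι : ∀ l, ι (ι l) = l)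
    (htype : ε = 1 ∨ (ε = -1 ∧ ∀ l, ι l ≠ l)) (hw : ∀ k, w (w k) = k) (hv : IsAdmBasis v)
    (hv' : IsAdmBasis v') (h : IsWDualInf ε ι w v) (h' : IsWDualInf ε ι w v') :
    ∃ c : ℕ → ℂ, (∀ k, c k * c (w k) =
        omegaInf ε ι (v (w k)) (v k) * omegaInf ε ι (v' (w k)) (v' k)) ∧
      (∀ k, c k * starRingEnd ℂ (c k) = 1) ∧ {k | c k ≠ 1}.Finite := by
  refine _root_.exists_phases hw (fun k => pmOne_mul ((h k _).2 rfl) ((h' k _).2 rfl))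
    (fun k => ?_) ((finite_ne_or_ne_comp hw hv hv').subset fun k hk => ?_)
  · rw [hw, omegaInf_symm hι htype (v k), omegaInf_symm hι htype (v' k)]
    linear_combination omegaInf ε ι (v (w k)) (v k) * omegaInf ε ι (v' (w k)) (v' k) *
      eps_mul_eps (eps_eq htype)
  · by_contra hcon
    simp only [Set.mem_ofPred_eq, not_or, not_not] at hcon
    exact hk (by rw [hcon.1, hcon.2]; exact pmOne_mul_self ((h' k _).2 rfl))

theorem ConjSigns.exists_phases (hι : ∀ l, ι (ι l) = l)
    (htype : ε = 1 ∨ (ε = -1 ∧ ∀ l, ι l ≠ l)) (hw : ∀ k, w (w k) = k) (hv : IsAdmBasis v)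
    (hv' : IsAdmBasis v') {t t' : ℕ → ℂ} (h : ConjSigns ε ι w v t) (h' : ConjSigns ε ι w v' t') :
    ∃ c : ℕ → ℂ, (∀ k, c k * c (w k) = t k * t' k) ∧
      (∀ k, c k * starRingEnd ℂ (c k) = 1) ∧ {k | c k ≠ 1}.Finite := by
  refine _root_.exists_phases hw (fun k => pmOne_mul (h k).1 (h' k).1)
    (fun k => ?_) ((finite_ne_or_ne_comp hw hv hv').subset fun k hk => ?_)
  · have h1 := h.mul_comp hι htype hw hv k
    have h2 := h'.mul_comp hι htype hw hv' k
    have h3 := pmOne_mul_self (pmOne_mul (h k).1 (h' k).1)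
    have h4 : t k * t' k * (t (w k) * t' (w k)) = 1 := by
      rw [← eps_mul_eps (eps_eq htype)]
      nth_rewrite 1 [← h1]
      rw [← h2]
      ring
    linear_combination (-(t (w k) * t' (w k))) * h3 + t k * t' k * h4
  · by_contra hcon
    simp only [Set.mem_ofPred_eq, not_or, not_not] at hcon
    refine hk ?_
    have h1 : t k • v' (w k) = t' k • v' (w k) := by rw [← (h' k).2, ← hcon.2, ← (h k).2, hcon.1]
    rw [smul_left_injective ℂ (hv'.1.ne_zero (w k)) h1]
    exact pmOne_mul_self (h' k).1

theorem IsWDualInf.mem_KsetInf (hv : IsAdmBasis v)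
    (h : IsWDualInf ε ι w v) (h' : IsWDualInf ε ι w v') {c : ℕ → ℂ}
    (hc : ∀ k, c k * c (w k) = omegaInf ε ι (v (w k)) (v k) * omegaInf ε ι (v' (w k)) (v' k))
    {g : (ℕ →₀ ℂ) →ₗ[ℂ] (ℕ →₀ ℂ)} (hg : g ∈ GEset) (hgv : ∀ k, g (v k) = c k • v' k) :
    g ∈ KsetInf ε ι := by
  refine _root_.mem_KsetInf hv hg fun k l => ?_
  rw [hgv, hgv]
  have h1 : omegaInf ε ι (c l • v' l) (c k • v' k) = c l * (c k * omegaInf ε ι (v' l) (v' k)) := by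
    rw [← omegaBilin_apply, map_smul, LinearMap.map_smul₂, smul_eq_mul, smul_eq_mul]
    rw [omegaBilin_apply]
    ring
  rw [h1]
  by_cases hl : l = w k
  · subst hl
    linear_combination omegaInf ε ι (v' (w k)) (v' k) * hc k +
      omegaInf ε ι (v (w k)) (v k) * pmOne_mul_self ((h' k _).2 rfl)
  · rw [(h' k l).1 hl, (h k l).1 hl, mul_zero, mul_zero]

theorem ConjSigns.mem_G0setInf (hv : IsAdmBasis v) {t t' : ℕ → ℂ} (h : ConjSigns ε ι w v t)
    (h' : ConjSigns ε ι w v' t') {c : ℕ → ℂ} (hc : ∀ k, c k * c (w k) = t k * t' k)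
    (hc1 : ∀ k, c k * starRingEnd ℂ (c k) = 1) {g : (ℕ →₀ ℂ) →ₗ[ℂ] (ℕ →₀ ℂ)} (hg : g ∈ GEset)
    (hgv : ∀ k, g (v k) = c k • v' k) : g ∈ G0setInf ε ι := by
  refine _root_.mem_G0setInf hv hg fun l => ?_
  rw [← gammaMap_apply, ← gammaMap_apply, (h l).2, map_smul, hgv, hgv, map_smulₛₗ, (h' l).2,
    smul_smul, smul_smul]
  congr 1
  linear_combination (-(t l * starRingEnd ℂ (c l))) * hc l + t l * c (w l) * hc1 l -
    starRingEnd ℂ (c l) * t' l * pmOne_mul_self (h l).1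

theorem ConjSigns.eq_omegaInf (hι : ∀ l, ι (ι l) = l) (htype : ε = 1 ∨ (ε = -1 ∧ ∀ l, ι l ≠ l))
    (hw : ∀ k, w (w k) = k) (hv : IsAdmBasis v) (h : IsWDualInf ε ι w v) {t : ℕ → ℂ}
    (ht : ConjSigns ε ι w v t) (k : ℕ) : t k = omegaInf ε ι (v (w k)) (v k) := by
  obtain ⟨r, hr, hr', -⟩ := hermForm_self (v (w k))
  have h1 : omegaBilin ε ι (v (w k)) (gammaMap ε ι (v (w k))) = ε * hermForm (v (w k)) (v (w k)) :=
    omegaInf_gammaInf hι htype _ _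
  rw [(ht (w k)).2, map_smul, hw, hr', omegaBilin_apply, smul_eq_mul] at h1
  have h2 := ht.mul_comp hι htype hw hv k
  have h3 : t k * omegaInf ε ι (v (w k)) (v k) = r := by
    have h4 := pmOne_mul_self (ht k).1
    have h5 := pmOne_mul_self (ht (w k)).1
    have h6 := eps_mul_eps (eps_eq htype)
    linear_combination ε * h1 + (r : ℂ) * h6 + omegaInf ε ι (v (w k)) (v k) *
      (t (w k) * h2 - t k * h5)
  have h0 : ¬ (r : ℂ) = -1 := fun hr1 => by
    have : r = -1 := by exact_mod_cast hr1
    linarith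
  have hs := (h k _).2 rfl
  rcases (ht k).1 with h4 | h4 <;> rcases hs with h5 | h5 <;> rw [h4, h5] at h3 ⊢
  · exact absurd (by rw [← h3]; norm_num) h0
  · exact absurd (by rw [← h3]; norm_num) h0

theorem IsWDualInf.map (h : IsWDualInf ε ι w v) {g : (ℕ →₀ ℂ) →ₗ[ℂ] (ℕ →₀ ℂ)}
    (hg : g ∈ KsetInf ε ι) : IsWDualInf ε ι w fun k => g (v k) := fun k l => by
  simp only [hg.2]
  exact h k l

theorem IsWConjInf.map (h : IsWConjInf ε ι w v) {g : (ℕ →₀ ℂ) →ₗ[ℂ] (ℕ →₀ ℂ)}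
    (hg : g ∈ G0setInf ε ι) : IsWConjInf ε ι w fun k => g (v k) := fun k => by
  simp only [hg.2]
  rcases h k with h | h <;> rw [h]
  · exact Or.inl rfl
  · exact Or.inr (map_neg g _)

theorem IsAdmBasis.exists_map (hv : IsAdmBasis v) (hv' : IsAdmBasis v') {c : ℕ → ℂ}
    (hc : ∀ k, c k * starRingEnd ℂ (c k) = 1) (hfin : {k | c k ≠ 1}.Finite) :
    ∃ g ∈ GEset, (∀ k, g (v k) = c k • v' k) ∧
      flagSet σ v' = mapFlagS g (flagSet σ v) := by
  have hc0 : ∀ k, c k ≠ 0 := fun k h => by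
    have := hc k
    simp [h] at this
  have h1 : ∀ k, hv.mapTo (fun k => c k • v' k) (v k) = c k • v' k := hv.mapTo_apply _
  refine ⟨_, hv.mapTo_mem (hv'.smul hc0 hfin), h1, ?_⟩
  rw [mapFlagS_flagSet]
  simp only [h1]
  exact (sameFlag_smul hc0 v').flagSet_eq

variable (σ)

theorem OsetInf_eq_orbit (hι : ∀ l, ι (ι l) = l) (htype : ε = 1 ∨ (ε = -1 ∧ ∀ l, ι l ≠ l))
    (hw : ∀ k, w (w k) = k) (hv : IsAdmBasis v) (h : IsWDualInf ε ι w v) :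
    OsetInf σ ε ι w = {S | ∃ g ∈ KsetInf ε ι, S = mapFlagS g (flagSet σ v)} := by
  ext S
  constructor
  · rintro ⟨v', hv', h', rfl⟩
    obtain ⟨c, hc, hc1, hfin⟩ := h.exists_phases hι htype hw hv hv' h'
    obtain ⟨g, hg, hgv, hS⟩ := hv.exists_map (σ := σ) hv' hc1 hfin
    exact ⟨g, h.mem_KsetInf hv h' hc hg hgv, hS⟩
  · rintro ⟨g, hg, rfl⟩
    exact ⟨_, hv.comp hg.1, h.map hg, mapFlagS_flagSet g v⟩

theorem OOsetInf_eq_orbit (hι : ∀ l, ι (ι l) = l) (htype : ε = 1 ∨ (ε = -1 ∧ ∀ l, ι l ≠ l))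
    (hw : ∀ k, w (w k) = k) (hv : IsAdmBasis v) (h : IsWConjInf ε ι w v) :
    OOsetInf σ ε ι w = {S | ∃ g ∈ G0setInf ε ι, S = mapFlagS g (flagSet σ v)} := by
  ext S
  constructor
  · rintro ⟨v', hv', h', rfl⟩
    obtain ⟨t, ht⟩ := h.exists_signs
    obtain ⟨t', ht'⟩ := h'.exists_signs
    obtain ⟨c, hc, hc1, hfin⟩ := ht.exists_phases hι htype hw hv hv' ht'
    obtain ⟨g, hg, hgv, hS⟩ := hv.exists_map (σ := σ) hv' hc1 hfin
    exact ⟨g, ht.mem_G0setInf hv ht' hc hc1 hg hgv, hS⟩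
  · rintro ⟨g, hg, rfl⟩
    exact ⟨_, hv.comp hg.1, h.map hg, mapFlagS_flagSet g v⟩

/-- The flags of the bases that are both `w`-dual and `w`-conjugate form an orbit. -/
theorem setOf_dual_conj_eq_orbit (hι : ∀ l, ι (ι l) = l)
    (htype : ε = 1 ∨ (ε = -1 ∧ ∀ l, ι l ≠ l)) (hw : ∀ k, w (w k) = k) (hv : IsAdmBasis v)
    (h : IsWDualInf ε ι w v) (hC : IsWConjInf ε ι w v) :
    {S | ∃ v', IsAdmBasis v' ∧ IsWDualInf ε ι w v' ∧ IsWConjInf ε ι w v' ∧ S = flagSet σ v'} =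
      {S | ∃ g ∈ KsetInf ε ι ∩ G0setInf ε ι, S = mapFlagS g (flagSet σ v)} := by
  ext S
  constructor
  · rintro ⟨v', hv', h', hC', rfl⟩
    obtain ⟨t, ht⟩ := hC.exists_signs
    obtain ⟨t', ht'⟩ := hC'.exists_signs
    obtain ⟨c, hc, hc1, hfin⟩ := h.exists_phases hι htype hw hv hv' h'
    obtain ⟨g, hg, hgv, hS⟩ := hv.exists_map (σ := σ) hv' hc1 hfin
    refine ⟨g, ⟨h.mem_KsetInf hv h' hc hg hgv, ht.mem_G0setInf hv ht' (fun k => ?_) hc1 hg hgv⟩,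
      hS⟩
    rw [hc, ht.eq_omegaInf hι htype hw hv h, ht'.eq_omegaInf hι htype hw hv' h']
  · rintro ⟨g, hg, rfl⟩
    exact ⟨_, hv.comp hg.1.1, h.map hg.1, hC.map hg.2, mapFlagS_flagSet g v⟩

end Orbits

section Existence

variable {ε : ℂ} {ι w : ℕ → ℕ}

theorem IsWDualInf.linearIndependent {v : ℕ → ℕ →₀ ℂ} (hw : ∀ k, w (w k) = k)
    (h : IsWDualInf ε ι w v) : LinearIndependent ℂ v := by
  rw [linearIndependent_iff]
  intro a ha
  ext k
  have h1 : omegaBilin ε ι (Finsupp.linearCombination ℂ v a) (v (w k)) =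
      a k * omegaInf ε ι (v k) (v (w k)) := by
    rw [← LinearMap.flip_apply, Finsupp.linearCombination_apply, map_finsuppSum, Finsupp.sum,
      Finset.sum_eq_single k]
    · rw [map_smul]; rfl
    · intro l _ hl
      rw [map_smul, LinearMap.flip_apply, omegaBilin_apply, (h (w k) l).1 (by rwa [hw]), smul_zero]
    · intro hk
      rw [Finsupp.notMem_support_iff.1 hk, zero_smul, map_zero]
  rw [ha, map_zero, LinearMap.zero_apply, eq_comm, mul_eq_zero] at h1
  have h2 := h.ne_zero (w k)
  rw [hw] at h2
  exact h1.resolve_right h2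

theorem exists_perm_conj_of_involutive {α : Type*} [Fintype α] [DecidableEq α]
    (a b : Equiv.Perm α) (ha : ∀ x, a (a x) = x) (hb : ∀ x, b (b x) = x) (ha' : ∀ x, a x ≠ x)
    (hb' : ∀ x, b x ≠ x) : ∃ τ : Equiv.Perm α, ∀ x, τ (a x) = b (τ x) := by
  rcases isEmpty_or_nonempty α with _ | ⟨⟨x₀⟩⟩
  · exact ⟨1, fun x => isEmptyElim x⟩
  have key : ∀ p : Equiv.Perm α, (∀ x, p (p x) = x) → (∀ x, p x ≠ x) →
      ∃ n, p.cycleType = Multiset.replicate n 2 ∧ n * 2 = Fintype.card α := by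
    intro p hp hp'
    have ho : orderOf p = 2 := by
      refine orderOf_eq_prime (Equiv.ext fun x => ?_) fun h => hp' x₀ (by rw [h]; rfl)
      rw [pow_two]
      exact hp x
    obtain ⟨n, hn⟩ := Equiv.Perm.cycleType_prime_order (σ := p) (ho ▸ Nat.prime_two)
    rw [ho] at hn
    refine ⟨n + 1, hn, ?_⟩
    have h1 := p.sum_cycleType
    rw [hn, Multiset.sum_replicate, smul_eq_mul] at h1
    rw [h1, ← Finset.card_univ]
    congr 1
    exact Finset.eq_univ_iff_forall.2 fun x => Equiv.Perm.mem_support.2 (hp' x)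
  obtain ⟨n, hn, hn'⟩ := key a ha ha'
  obtain ⟨m, hm, hm'⟩ := key b hb hb'
  have hnm : n = m := by omega
  have hc : IsConj a b := by rw [Equiv.Perm.isConj_iff_cycleType_eq, hn, hm, hnm]
  obtain ⟨τ, hτ⟩ := isConj_iff.1 hc
  refine ⟨τ, fun x => ?_⟩
  rw [← hτ]
  simp

theorem exists_perm_conj (hι : ∀ l, ι (ι l) = l) (hι' : ∀ l, ι l ≠ l) (hw : ∀ l, w (w l) = l)
    (hw' : ∀ l, w l ≠ l) (hfin : {l | w l ≠ ι l}.Finite) :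
    ∃ τ : Equiv.Perm ℕ, (∀ l, τ (w l) = ι (τ l)) ∧ {l | τ l ≠ l}.Finite := by
  classical
  have hFw : ∀ l, w (w l) ≠ ι (w l) ↔ w l ≠ ι l := fun l => by
    rw [hw, not_iff_not]
    exact ⟨fun h => by rw [h, hι, ← h], fun h => by rw [h, hι]⟩
  have hFι : ∀ l, w (ι l) ≠ ι (ι l) ↔ w l ≠ ι l := fun l => by
    rw [hι, not_iff_not]
    exact ⟨fun h => by nth_rewrite 1 [← h]; rw [hw], fun h => by rw [← h, hw]⟩
  have : Fintype {l // w l ≠ ι l} := hfin.fintype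
  obtain ⟨τ, hτ⟩ := exists_perm_conj_of_involutive
    ((Function.Involutive.toPerm w hw).subtypePerm (p := fun l => w l ≠ ι l) hFw)
    ((Function.Involutive.toPerm ι hι).subtypePerm (p := fun l => w l ≠ ι l) hFι)
    (fun x => Subtype.ext (hw x)) (fun x => Subtype.ext (hι x))
    (fun x h => hw' x (congrArg Subtype.val h)) (fun x h => hι' x (congrArg Subtype.val h))
  have hn : ∀ l, ¬ w l ≠ ι l → Equiv.Perm.ofSubtype τ l = l := fun l hl =>
    Equiv.Perm.ofSubtype_apply_of_not_mem τ hl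
  refine ⟨Equiv.Perm.ofSubtype τ, fun l => ?_, hfin.subset fun l hl => ?_⟩
  · by_cases hl : w l ≠ ι l
    · rw [Equiv.Perm.ofSubtype_apply_of_mem τ hl, Equiv.Perm.ofSubtype_apply_of_mem τ ((hFw l).2 hl)]
      exact congrArg Subtype.val (hτ ⟨l, hl⟩)
    · rw [hn l hl, hn (w l) (by rwa [hFw])]
      exact not_not.1 hl
  · by_contra h
    exact hl (hn l h)

theorem exists_dual_conj_of_neg_one (hι : ∀ l, ι (ι l) = l) (hι' : ∀ l, ι l ≠ l)
    (hw : InIinf (-1) ι w) :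
    ∃ v, IsAdmBasis v ∧ IsWDualInf (-1) ι w v ∧ IsWConjInf (-1) ι w v := by
  obtain ⟨τ, hτ, hfin⟩ := exists_perm_conj hι hι' hw.1 (hw.2.2 rfl) hw.2.1
  have hs : ∀ i, omegaSign (-1) ι i = 1 ∨ omegaSign (-1) ι i = -1 := omegaSign_eq (Or.inr rfl)
  have hd : IsWDualInf (-1) ι w fun l => eB (τ l) := by
    intro k l
    have h1 : ι (τ l) = τ k ↔ l = w k := by
      rw [← hτ, τ.injective.eq_iff]
      exact ⟨fun h => by rw [← h, hw.1], fun h => by rw [h, hw.1]⟩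
    simp only [omegaInf_eB, h1]
    exact ⟨fun h => if_neg h, fun h => by rw [if_pos h]; exact hs _⟩
  refine ⟨fun l => eB (τ l), isAdmBasis_of_linearIndependent ?_ (hd.linearIndependent hw.1), hd,
    fun k => ?_⟩
  · refine hfin.subset fun l hl h => hl ?_
    rw [h]
  · beta_reduce
    rw [gammaInf_eB hι, hτ]
    rcases hs (ι (τ k)) with h | h <;> rw [h]
    · exact Or.inl (one_smul _ _)
    · exact Or.inr (by rw [neg_smul, one_smul])

theorem exists_dual_conj_of_one (hι : ∀ l, ι (ι l) = l) (hw : InIinf 1 ι w) :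
    ∃ v, IsAdmBasis v ∧ IsWDualInf 1 ι w v ∧ IsWConjInf 1 ι w v := by
  obtain ⟨α, hα⟩ : ∃ α : ℂ, α = (1 + Complex.I) / 2 := ⟨_, rfl⟩
  obtain ⟨β, hβ⟩ : ∃ β : ℂ, β = (1 - Complex.I) / 2 := ⟨_, rfl⟩
  have hI := Complex.I_mul_I
  have hαβ : α * β = 1 / 2 := by rw [hα, hβ]; linear_combination (-1 / 4) * hI
  have hsq : α * α + β * β = 0 := by rw [hα, hβ]; linear_combination (1 / 2) * hI
  have hcα : starRingEnd ℂ α = β := by rw [hα, hβ]; simp [sub_eq_add_neg, map_ofNat]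
  have hcβ : starRingEnd ℂ β = α := by rw [← hcα, Complex.conj_conj]
  have hs : ∀ i, omegaSign 1 ι i = 1 := fun i => by simp [omegaSign]
  have hinj := Function.Involutive.injective hι
  have hwinj := Function.Involutive.injective hw.1
  obtain ⟨u, hu⟩ : ∃ u : ℕ → ℕ →₀ ℂ, u = fun l => α • eB l + β • eB (ι l) := ⟨_, rfl⟩
  have hγu : ∀ l, gammaMap 1 ι (u l) = u l := fun l => by
    simp only [hu, map_add, map_smulₛₗ, gammaMap_apply, gammaInf_eB hι, hs, hι, one_smul, hcα, hcβ]
    rw [add_comm]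
  have hωu : ∀ l k, omegaBilin 1 ι (u l) (u k) = if l = k then 1 else 0 := fun l k => by
    have h1 : (ι l = ι k) = (l = k) := propext hinj.eq_iff
    have h2 : (l = ι k) = (ι l = k) :=
      propext ⟨fun h => by rw [h, hι], fun h => by rw [← h, hι]⟩
    simp only [hu, map_add, map_smul, LinearMap.add_apply, LinearMap.smul_apply, omegaBilin_apply,
      omegaInf_eB, hs, hι, smul_eq_mul, h1, h2]
    split_ifs
    · linear_combination 2 * hαβ + hsq
    · linear_combination hsq
    · linear_combination 2 * hαβ
    · ring
  obtain ⟨v, hv⟩ : ∃ v : ℕ → ℕ →₀ ℂ, v = fun l => β • u l + α • u (w l) := ⟨_, rfl⟩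
  have hd : IsWDualInf 1 ι w v := by
    have key : ∀ l k, omegaInf 1 ι (v l) (v k) = if l = w k then 1 else 0 := fun l k => by
      have h1 : (w l = w k) = (l = k) := propext hwinj.eq_iff
      have h2 : (w l = k) = (l = w k) :=
        propext ⟨fun h => by rw [← h, hw.1], fun h => by rw [h, hw.1]⟩
      rw [← omegaBilin_apply]
      simp only [hv, map_add, map_smul, LinearMap.add_apply, LinearMap.smul_apply, hωu,
        smul_eq_mul, h1, h2]
      split_ifs
      · linear_combination 2 * hαβ + hsq
      · linear_combination hsq
      · linear_combination 2 * hαβ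
      · ring
    intro k l
    rw [key]
    exact ⟨fun h => if_neg h, fun h => Or.inl (if_pos h)⟩
  refine ⟨v, isAdmBasis_of_linearIndependent ?_ (hd.linearIndependent hw.1), hd,
    fun k => Or.inl ?_⟩
  · refine hw.2.1.subset fun l hl h => hl ?_
    have h1 : v l = (2 * (α * β)) • eB l + (α * α + β * β) • eB (ι l) := by
      simp only [hv, hu, h, hι]
      module
    rw [h1, hαβ, hsq, zero_smul, add_zero]
    norm_num
  · rw [← gammaMap_apply]
    simp only [hv, map_add, map_smulₛₗ, hγu, hcα, hcβ, hw.1]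
    rw [add_comm]

theorem InIinf.exists_dual_conj (hι : ∀ l, ι (ι l) = l)
    (htype : ε = 1 ∨ (ε = -1 ∧ ∀ l, ι l ≠ l)) (hw : InIinf ε ι w) :
    ∃ v, IsAdmBasis v ∧ IsWDualInf ε ι w v ∧ IsWConjInf ε ι w v := by
  rcases htype with rfl | ⟨rfl, hι'⟩
  · exact exists_dual_conj_of_one hι hw
  · exact exists_dual_conj_of_neg_one hι hι' hw

end Existence

section Intersection

variable {A : Type*} [LinearOrder A] {σ : ℕ → A} {ε : ℂ} {ι w : ℕ → ℕ} {u v v' : ℕ → ℕ →₀ ℂ}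

theorem hermForm_self_ne_zero {x : ℕ →₀ ℂ} (hx : x ≠ 0) : hermForm x x ≠ 0 := by
  obtain ⟨r, -, hr, h0⟩ := hermForm_self x
  intro h
  rw [hr] at h
  exact hx (h0 (by exact_mod_cast h))

theorem IsAdmBasis.exists_orthonormal (hσ : Function.Injective σ) (hv : IsAdmBasis v) :
    ∃ u, IsAdmBasis u ∧ SameFlag σ v u ∧
      ∀ l k, hermForm (u l) (u k) = if l = k then 1 else 0 := by
  obtain ⟨p, u, h⟩ := hv.exists_formReduced hσ (B := hermForm) (η := 1) (ι₀ := id) (fun _ => rfl)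
    (Or.inl rfl) (fun x y => by rw [one_mul]; exact hermForm_symm x y)
    (fun x hx => by
      obtain ⟨r, hr0, hr, -⟩ := hermForm_self x
      have hr' : (r : ℂ) ≠ 0 := hr ▸ hx
      refine ⟨((Real.sqrt r)⁻¹ : ℝ), ?_⟩
      have h1 : (Real.sqrt r)⁻¹ * (Real.sqrt r)⁻¹ * r = 1 := by
        rw [← mul_inv, Real.mul_self_sqrt hr0]
        exact inv_mul_cancel₀ (by exact_mod_cast hr')
      rw [hr, Complex.conj_ofReal]
      exact_mod_cast h1)
    (fun x hx => by
      by_contra h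
      exact hermForm_self_ne_zero h (hx x))
    (fun k l hkl => by rw [hermForm_eB]; exact if_neg hkl)
    (fun k => Or.inl (by rw [hermForm_eB]; exact if_pos rfl))
  have hp : ∀ k, p k = k := fun k => by
    by_contra hk
    exact hermForm_self_ne_zero (h.adm.1.ne_zero k)
      (h.zero k (Finset.notMem_empty k) k fun h => hk h.symm)
  refine ⟨u, h.adm, h.flag, fun l k => ?_⟩
  split_ifs with hlk
  · subst hlk
    obtain ⟨r, hr0, hr, -⟩ := hermForm_self (u l)
    have h1 := h.pm l (Finset.notMem_empty l)
    rw [hp] at h1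
    refine h1.resolve_right fun h1 => ?_
    rw [hr] at h1
    have h2 : r = -1 := by exact_mod_cast h1
    linarith
  · exact h.zero k (Finset.notMem_empty k) l (by rwa [hp])

theorem eq_smul_of_orthonormal (hu : IsAdmBasis u)
    (hon : ∀ l k, hermForm (u l) (u k) = if l = k then 1 else 0) {x : ℕ →₀ ℂ} {m : ℕ}
    (h : ∀ j, j ≠ m → hermForm x (u j) = 0) : x = hermForm x (u m) • u m := by
  rw [← sub_eq_zero]
  by_contra hne
  refine hermForm_self_ne_zero hne ?_
  refine apply_eq_zero_of_mem_span (hermForm (x - hermForm x (u m) • u m)) (v := u) (I := Set.univ)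
    (fun j _ => ?_) ?_
  · rw [map_sub, map_smul, LinearMap.sub_apply, LinearMap.smul_apply, hon]
    by_cases hj : j = m
    · subst hj
      simp
    · rw [h j hj, if_neg (Ne.symm hj)]
      simp
  · rw [Set.image_univ, hu.2.1]
    exact Submodule.mem_top

theorem exists_gammaMap_eq_smul (hσ : Function.Injective σ) (hι : ∀ l, ι (ι l) = l)
    (htype : ε = 1 ∨ (ε = -1 ∧ ∀ l, ι l ≠ l)) (hw : InIinf ε ι w) (hu : IsAdmBasis u)
    (hon : ∀ l k, hermForm (u l) (u k) = if l = k then 1 else 0)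
    (hv : IsAdmBasis v) (hd : IsWDualInf ε ι w v) (hvu : SameFlag σ v u)
    (hv' : IsAdmBasis v') (hc : IsWConjInf ε ι w v') (hvu' : SameFlag σ v' u) (l : ℕ) :
    ∃ t : ℂ, gammaMap ε ι (u l) = t • u (w l) := by
  have hon0 : ∀ {l k}, l ≠ k → hermForm (u l) (u k) = 0 := fun h => by rw [hon, if_neg h]
  have hbad : {l | ¬ ∃ t : ℂ, gammaMap ε ι (u l) = t • u (w l)}.Finite := by
    refine ((finite_ne_or_ne_comp hw.1 hu isAdmBasis_eB).union hw.2.1).subset fun k hk => ?_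
    by_contra hcon
    simp only [Set.mem_union, Set.mem_ofPred_eq, not_or, not_not] at hcon
    exact hk ⟨_, by rw [hcon.1.1, gammaMap_apply, gammaInf_eB hι, hcon.1.2, hcon.2]⟩
  by_contra hl
  obtain ⟨l, hl, hmin⟩ := Set.exists_min_image _ σ hbad ⟨l, hl⟩
  have hgood : ∀ k, σ k < σ l → ∃ t : ℂ, gammaMap ε ι (u k) = t • u (w k) := fun k hk => by
    by_contra hk'
    exact (hmin k hk').not_gt hk
  refine hl ⟨_, eq_smul_of_orthonormal hu hon fun j hj => ?_⟩
  have hjl : w j ≠ l := fun h => hj (by rw [← h, hw.1])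
  rcases lt_or_gt_of_ne (hσ.ne hjl) with hlt | hlt
  · obtain ⟨t, ht⟩ := hgood _ hlt
    rw [hw.1] at ht
    have h1 : hermForm (gammaMap ε ι (u l)) (gammaMap ε ι (u (w j))) =
        starRingEnd ℂ (hermForm (u l) (u (w j))) := hermForm_gammaInf_gammaInf hι htype _ _
    have h2 : t ≠ 0 := by
      rintro rfl
      have h3 : hermForm (gammaMap ε ι (u (w j))) (gammaMap ε ι (u (w j))) =
        starRingEnd ℂ (hermForm (u (w j)) (u (w j))) := hermForm_gammaInf_gammaInf hι htype _ _
      rw [ht, hon, if_pos rfl] at h3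
      simp at h3
    rw [hon0 (Ne.symm hjl), map_zero, ht, map_smulₛₗ, smul_eq_mul] at h1
    exact (mul_eq_zero.1 h1).resolve_left ((map_ne_zero _).2 h2)
  · have hy : ∀ y ∈ flagLT σ u (σ l), hermForm (gammaMap ε ι y) (u j) = 0 := fun y hy => by
      refine apply_eq_zero_of_mem_span ((hermForm.flip (u j)).comp (gammaMap ε ι))
        (fun k hk => ?_) hy
      obtain ⟨t, ht⟩ := hgood k hk
      have hkj : w k ≠ j := fun h => (lt_trans hk hlt).ne (by rw [← h, hw.1])
      rw [LinearMap.comp_apply, ht, LinearMap.flip_apply, map_smul, LinearMap.smul_apply,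
        hon0 hkj, smul_zero]
    have key : ∀ x : ℕ → ℕ →₀ ℂ, IsAdmBasis x → SameFlag σ x u →
        hermForm (gammaMap ε ι (x l)) (u j) = 0 → hermForm (gammaMap ε ι (u l)) (u j) = 0 := by
      intro x hx hxu h0
      obtain ⟨c, hc, y, hy', hl⟩ := hxu.exists_eq hσ hx l
      rw [hl, map_add, map_smulₛₗ, map_add, LinearMap.add_apply, hy y hy', add_zero, map_smul,
        LinearMap.smul_apply, smul_eq_mul] at h0
      exact (mul_eq_zero.1 h0).resolve_left ((map_ne_zero _).2 hc)
    rcases lt_or_gt_of_ne (hσ.ne hj) with hjw | hjw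
    · refine key v hv hvu ?_
      have h1 : hermForm (gammaMap ε ι (v l)) (u j) = starRingEnd ℂ (omegaInf ε ι (u j) (v l)) :=
        hermForm_gammaInf_left hι htype _ _
      have h2 : u j ∈ flagLE σ v (σ j) := (hvu _).2 ▸ mem_flagLE le_rfl
      have h3 : omegaBilin ε ι (u j) (v l) = 0 :=
        apply_eq_zero_of_mem_span ((omegaBilin ε ι).flip (v l))
          (fun k hk => (hd l k).1 fun hkl => (lt_of_le_of_lt hk hjw).ne (by rw [hkl])) h2
      rw [h1, ← omegaBilin_apply, h3, map_zero]
    · refine key v' hv' hvu' ?_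
      have h1 : gammaMap ε ι (v' l) ∈ flagLE σ u (σ (w l)) := by
        rw [← (hvu' _).2]
        rcases hc l with h | h <;> rw [gammaMap_apply, h]
        · exact mem_flagLE le_rfl
        · exact neg_mem (mem_flagLE le_rfl)
      exact apply_eq_zero_of_mem_span (hermForm.flip (u j))
        (fun k hk => hon0 fun hkj => (lt_of_le_of_lt hk hjw).ne (by rw [hkj])) h1

theorem exists_phases_of_unit (hw : ∀ k, w (w k) = k) (hε : ε = 1 ∨ ε = -1) {t : ℕ → ℂ}
    (ht : ∀ k, t k * starRingEnd ℂ (t k) = 1) (htw : ∀ k, t (w k) = ε * t k)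
    (hfin : {k | ¬ (t k = 1 ∨ t k = -1)}.Finite) :
    ∃ d : ℕ → ℂ, (∀ k, d k * starRingEnd ℂ (d k) = 1) ∧ {k | d k ≠ 1}.Finite ∧
      ∀ k, starRingEnd ℂ (d k) * t k = d (w k) ∨ starRingEnd ℂ (d k) * t k = -d (w k) := by
  classical
  have hsq : ∀ k, ∃ s : ℂ, s ^ 2 = t k := fun k => IsAlgClosed.exists_pow_nat_eq _ two_pos
  choose s hs using hsq
  have hs1 : ∀ k, s k * starRingEnd ℂ (s k) = 1 := fun k => by
    have h1 := ht k
    rw [Complex.mul_conj] at h1 ⊢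
    have h2 : Complex.normSq (t k) = 1 := by exact_mod_cast h1
    rw [← hs, map_pow, pow_eq_one_iff_of_nonneg (Complex.normSq_nonneg _) two_ne_zero] at h2
    rw [h2, Complex.ofReal_one]
  have hpm : ∀ k, (t (w k) = 1 ∨ t (w k) = -1) ↔ (t k = 1 ∨ t k = -1) := fun k => by
    rw [htw]
    rcases hε with rfl | rfl
    · rw [one_mul]
    · rw [neg_one_mul, neg_inj, neg_eq_iff_eq_neg, or_comm]
  refine ⟨fun k => if t k = 1 ∨ t k = -1 then 1 else if w k = k then s k else
    if k < w k then t k else 1, fun k => ?_, hfin.subset fun k hk h1 => hk (if_pos h1), fun k => ?_⟩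
  · beta_reduce
    split_ifs
    · simp
    · exact hs1 k
    · exact ht k
    · simp
  · simp only [hpm, hw]
    by_cases h : t k = 1 ∨ t k = -1
    · rw [if_pos h, if_pos h, map_one, one_mul]
      exact h
    · rw [if_neg h, if_neg h]
      rcases lt_trichotomy (w k) k with hlt | heq | hlt
      · rw [if_neg hlt.ne, if_neg hlt.not_gt, if_neg hlt.ne', if_pos hlt, map_one, one_mul, htw]
        rcases hε with rfl | rfl
        · exact Or.inl (one_mul _).symm
        · exact Or.inr (by ring)
      · rw [if_pos heq, if_pos heq.symm, heq]
        left
        rw [← hs]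
        linear_combination s k * hs1 k
      · rw [if_neg hlt.ne', if_pos hlt, if_neg hlt.ne, if_neg hlt.not_gt]
        left
        rw [mul_comm, ht]

theorem exists_dual_conj_sameFlag (hσ : Function.Injective σ) (hι : ∀ l, ι (ι l) = l)
    (htype : ε = 1 ∨ (ε = -1 ∧ ∀ l, ι l ≠ l)) (hw : InIinf ε ι w)
    (hv : IsAdmBasis v) (hd : IsWDualInf ε ι w v) (hv' : IsAdmBasis v')
    (hc : IsWConjInf ε ι w v') (hf : SameFlag σ v v') :
    ∃ x, IsAdmBasis x ∧ IsWDualInf ε ι w x ∧ IsWConjInf ε ι w x ∧ SameFlag σ v x := by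
  obtain ⟨u, hu, hvu, hon⟩ := hv.exists_orthonormal hσ
  have hγ := exists_gammaMap_eq_smul hσ hι htype hw hu hon hv hd hvu hv' hc (hf.symm.trans hvu)
  choose t ht using hγ
  have ht1 : ∀ k, t k * starRingEnd ℂ (t k) = 1 := fun k => by
    have h1 : hermForm (gammaMap ε ι (u k)) (gammaMap ε ι (u k)) =
        starRingEnd ℂ (hermForm (u k) (u k)) := hermForm_gammaInf_gammaInf hι htype _ _
    rwa [ht, hon, if_pos rfl, map_one, map_smulₛₗ, map_smul, LinearMap.smul_apply, hon, if_pos rfl,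
      smul_eq_mul, smul_eq_mul, mul_one, mul_comm] at h1
  have htw : ∀ k, t (w k) = ε * t k := fun k => by
    have h1 : gammaMap ε ι (gammaMap ε ι (u k)) = ε • u k := gammaInf_gammaInf hι htype (u k)
    rw [ht, map_smulₛₗ, ht, hw.1, smul_smul] at h1
    have h2 : starRingEnd ℂ (t k) * t (w k) = ε := smul_left_injective ℂ (hu.1.ne_zero k) h1
    linear_combination t k * h2 - t (w k) * ht1 k
  have hfin : {k | ¬ (t k = 1 ∨ t k = -1)}.Finite := by
    refine ((finite_ne_or_ne_comp hw.1 hu isAdmBasis_eB).union hw.2.1).subset fun k hk => ?_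
    by_contra hcon
    simp only [Set.mem_union, Set.mem_ofPred_eq, not_or, not_not] at hcon
    refine hk ?_
    have h1 := ht k
    rw [hcon.1.1, gammaMap_apply, gammaInf_eB hι, hcon.1.2, hcon.2] at h1
    rw [← smul_left_injective ℂ (isAdmBasis_eB.1.ne_zero (ι k)) h1]
    exact omegaSign_eq (eps_eq htype) _
  obtain ⟨d, hd1, hdfin, hdt⟩ := exists_phases_of_unit hw.1 (eps_eq htype) ht1 htw hfin
  have hd0 : ∀ k, d k ≠ 0 := fun k h => by
    have := hd1 k
    simp [h] at this
  have hC : IsWConjInf ε ι w fun k => d k • u k := fun k => by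
    rw [← gammaMap_apply, map_smulₛₗ, ht, smul_smul]
    rcases hdt k with h | h <;> rw [h]
    · exact Or.inl rfl
    · exact Or.inr (neg_smul _ _)
  have hon' : ∀ l k, hermForm (d l • u l) (d k • u k) = if l = k then 1 else 0 := fun l k => by
    rw [map_smulₛₗ, map_smul, LinearMap.smul_apply, hon]
    split_ifs with h
    · subst h
      rw [smul_eq_mul, smul_eq_mul, mul_one, mul_comm, hd1]
    · rw [smul_zero, smul_zero]
  refine ⟨fun k => d k • u k, hu.smul hd0 hdfin, fun k l => ?_, hC,
    hvu.trans (sameFlag_smul hd0 u)⟩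
  have h1 := hC (w k)
  have h2 : omegaBilin ε ι (d l • u l) (gammaInf ε ι (d (w k) • u (w k))) =
      ε * hermForm (d l • u l) (d (w k) • u (w k)) := omegaInf_gammaInf hι htype _ _
  rw [hon'] at h2
  simp only [hw.1] at h1
  simp only [← omegaBilin_apply]
  refine ⟨fun h => ?_, fun h => ?_⟩
  · rw [if_neg h, mul_zero] at h2
    rcases h1 with h1 | h1 <;> rw [h1] at h2
    · exact h2
    · rwa [map_neg, neg_eq_zero] at h2
  · rw [if_pos h, mul_one] at h2
    rcases h1 with h1 | h1 <;> rw [h1] at h2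
    · rw [h2]
      exact eps_eq htype
    · rw [map_neg, neg_eq_iff_eq_neg] at h2
      rw [h2, neg_eq_iff_eq_neg, neg_inj, or_comm]
      exact eps_eq htype

theorem OsetInf_inter_OOsetInf (hσ : Function.Injective σ) (hι : ∀ l, ι (ι l) = l)
    (htype : ε = 1 ∨ (ε = -1 ∧ ∀ l, ι l ≠ l)) (hw : InIinf ε ι w) :
    OsetInf σ ε ι w ∩ OOsetInf σ ε ι w =
      {S | ∃ v, IsAdmBasis v ∧ IsWDualInf ε ι w v ∧ IsWConjInf ε ι w v ∧ S = flagSet σ v} := by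
  ext S
  constructor
  · rintro ⟨⟨v, hv, hd, rfl⟩, v', hv', hc, hS⟩
    obtain ⟨x, hx, hdx, hcx, hvx⟩ := exists_dual_conj_sameFlag hσ hι htype hw hv hd hv' hc
      (sameFlag_of_flagSet_eq hv hv' hS)
    exact ⟨x, hx, hdx, hcx, hvx.flagSet_eq⟩
  · rintro ⟨v, hv, hd, hc, rfl⟩
    exact ⟨⟨v, hv, hd, rfl⟩, v, hv, hc, rfl⟩

end Intersection

/-- the sets `𝓞_w` for `w ∈ 𝕀_∞^ε(ι)` are exactly the `K`-orbits of `X`,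
the sets `𝕺_w` are exactly the `G⁰`-orbits of `X` (each a single orbit, pairwise
disjoint, union `X`), and each intersection `𝓞_w ∩ 𝕺_w` is a single `K ∩ G⁰`-orbit. -/
theorem stmt_15 {A : Type*} [LinearOrder A] (σ : ℕ → A) (hσ : Function.Bijective σ)
    (ε : ℂ) (ι : ℕ → ℕ)
    (hι : ∀ ℓ, ι (ι ℓ) = ℓ)
    (hadj : ∀ ℓ, ι ℓ = ℓ + 1 ∨ ℓ = ι ℓ + 1 ∨ ι ℓ = ℓ)
    (htype : ε = 1 ∨ (ε = -1 ∧ ∀ ℓ, ι ℓ ≠ ℓ)) :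
    (∀ w : ℕ → ℕ, InIinf ε ι w →
        IsOrbitS (KsetInf ε ι) (Xinf σ) (OsetInf σ ε ι w)) ∧
    (∀ w w' : ℕ → ℕ, InIinf ε ι w → InIinf ε ι w' → w ≠ w' →
        OsetInf σ ε ι w ∩ OsetInf σ ε ι w' = ∅) ∧
    (Xinf σ = {S | ∃ w : ℕ → ℕ, InIinf ε ι w ∧ S ∈ OsetInf σ ε ι w}) ∧
    (∀ w : ℕ → ℕ, InIinf ε ι w →
        IsOrbitS (G0setInf ε ι) (Xinf σ) (OOsetInf σ ε ι w)) ∧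
    (∀ w w' : ℕ → ℕ, InIinf ε ι w → InIinf ε ι w' → w ≠ w' →
        OOsetInf σ ε ι w ∩ OOsetInf σ ε ι w' = ∅) ∧
    (Xinf σ = {S | ∃ w : ℕ → ℕ, InIinf ε ι w ∧ S ∈ OOsetInf σ ε ι w}) ∧
    (∀ w : ℕ → ℕ, InIinf ε ι w →
        ∃ S₀ ∈ OsetInf σ ε ι w ∩ OOsetInf σ ε ι w,
          OsetInf σ ε ι w ∩ OOsetInf σ ε ι w =
            {S | ∃ g ∈ KsetInf ε ι ∩ G0setInf ε ι, S = mapFlagS g S₀}) := by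
  refine ⟨fun w hw => ?_, fun w w' hw hw' hne => OsetInf_inter_eq_empty hσ.1 hw.1 hw'.1 hne,
    Xinf_eq_iUnion_OsetInf hσ.1 hι htype, fun w hw => ?_,
    fun w w' hw hw' hne => OOsetInf_inter_eq_empty hσ.1 hw.1 hw'.1 hne,
    Xinf_eq_iUnion_OOsetInf hσ.1 hι htype, fun w hw => ?_⟩ <;>
  obtain ⟨v, hv, hd, hc⟩ := hw.exists_dual_conj hι htype
  · exact ⟨flagSet σ v, mem_Xinf.2 ⟨v, hv, rfl⟩, OsetInf_eq_orbit σ hι htype hw.1 hv hd⟩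
  · exact ⟨flagSet σ v, mem_Xinf.2 ⟨v, hv, rfl⟩, OOsetInf_eq_orbit σ hι htype hw.1 hv hc⟩
  · refine ⟨flagSet σ v, ⟨⟨v, hv, hd, rfl⟩, v, hv, hc, rfl⟩, ?_⟩
    rw [OsetInf_inter_OOsetInf hσ.1 hι htype hw]
    exact setOf_dual_conj_eq_orbit σ hι htype hw.1 hv hd hc
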